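/- arXiv:1307.0495 — 3 statements merged into one kernel-verified Lean document; each statement's English description precedes it below -/
import Mathlib

section
/- For every n ≥ 1, the number of ordered set partitions of [n] into n-1 blocks avoiding the pattern 321 equals 3(n-1)^2/(n(n+1)) · C(2n-2, n-1). -/
open Finset BigOperators

/-- A word `w` of length `n` over the alphabet `[k]` contains the permutation
pattern `p` of length `m`. -/
def WordContains {n k m : ℕ} (w : Fin n → Fin k) (p : Equiv.Perm (Fin m)) : Prop :=
  ∃ ι : Fin m → Fin n, StrictMono ι ∧ ∀ a b : Fin m, w (ι a) < w (ι b) ↔ p a < p b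

/-- The number of words of length `n` over the alphabet `[k]` avoiding the pattern `p`. -/
noncomputable def wordAvoidCount (n k m : ℕ) (p : Equiv.Perm (Fin m)) : ℕ :=
  Nat.card {w : Fin n → Fin k // ¬ WordContains w p}

/-- An ordered set partition of `[n]` into `k` blocks. -/
structure OrdPartition (n k : ℕ) where
  blocks : Fin k → Finset (Fin n)
  blocks_nonempty : ∀ i, (blocks i).Nonempty
  blocks_disjoint : ∀ i j, i ≠ j → Disjoint (blocks i) (blocks j)
  blocks_cover : ∀ x : Fin n, ∃ i, x ∈ blocks i

/-- An ordered set partition contains the permutation pattern `p`. -/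
def OPContains {n k m : ℕ} (P : OrdPartition n k) (p : Equiv.Perm (Fin m)) : Prop :=
  ∃ ι : Fin m → Fin k, StrictMono ι ∧ ∃ b : Fin m → Fin n,
    (∀ j, b j ∈ P.blocks (ι j)) ∧ ∀ a c : Fin m, b a < b c ↔ p a < p c

/-- The number of ordered set partitions of `[n]` into `k` blocks avoiding `p`. -/
noncomputable def opAvoidCount (n k m : ℕ) (p : Equiv.Perm (Fin m)) : ℕ :=
  Nat.card {P : OrdPartition n k // ¬ OPContains P p}

/-- The pattern 321. -/
def p321 : Equiv.Perm (Fin 3) := Fin.revPerm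

/-- Ballot numbers. -/
def ballot : ℕ → ℕ → ℤ
  | _, 0 => 1
  | 0, b + 1 => ballot 1 b
  | a + 1, b + 1 => ballot a (b + 1) + ballot (a + 2) b
termination_by a b => (b, a)

/-- The differences `ballot a b - ballot a (b - 1)`. -/
def ballotDiff : ℕ → ℕ → ℤ
  | _, 0 => 1
  | a, b + 1 => ballot a (b + 1) - ballot a b

theorem ballot_eq_choose (b a : ℕ) :
    ballot a (b + 1) = (a + 2 * b + 2).choose (b + 1) - (a + 2 * b + 2).choose b := by
  induction b generalizing a with
  | zero =>
    induction a with
    | zero => simp [ballot]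
    | succ a ih => rw [ballot, ih]; simp [ballot]; ring
  | succ b ihb =>
    induction a with
    | zero =>
      rw [ballot, ihb]
      have h1 := Nat.choose_succ_succ (2 * b + 3) (b + 1)
      have h2 := Nat.choose_succ_succ (2 * b + 3) b
      have h3 : (2 * b + 3).choose (b + 2) = (2 * b + 3).choose (b + 1) :=
        Nat.choose_symm_of_eq_add (by ring)
      have e1 : 0 + 2 * (b + 1) + 2 = 2 * b + 3 + 1 := by ring
      have e2 : 1 + 2 * b + 2 = 2 * b + 3 := by ring
      rw [e1, e2]
      simp only [Nat.succ_eq_add_one] at h1 h2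
      push_cast [h1, h2, h3]
      ring
    | succ a iha =>
      rw [ballot, iha, ihb]
      have h1 := Nat.choose_succ_succ (a + 2 * b + 4) (b + 1)
      have h2 := Nat.choose_succ_succ (a + 2 * b + 4) b
      have e1 : a + 1 + 2 * (b + 1) + 2 = a + 2 * b + 4 + 1 := by ring
      have e2 : a + 2 * (b + 1) + 2 = a + 2 * b + 4 := by ring
      have e3 : a + 2 + 2 * b + 2 = a + 2 * b + 4 := by ring
      rw [e1, e2, e3]
      simp only [Nat.succ_eq_add_one] at h1 h2
      push_cast [h1, h2]
      ring

theorem succ_mul_ballot_zero (n : ℕ) : ((n : ℤ) + 1) * ballot 0 n = (2 * n).choose n := by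
  cases n with
  | zero => simp [ballot]
  | succ b =>
    rw [ballot_eq_choose]
    have h := Nat.choose_succ_right_eq (2 * b + 2) b
    have e : 2 * b + 2 - b = b + 2 := by omega
    rw [e] at h
    have h' : ((2 * b + 2).choose (b + 1) : ℤ) * (b + 1) = (2 * b + 2).choose b * (b + 2) := by
      exact_mod_cast h
    have e1 : 0 + 2 * b + 2 = 2 * b + 2 := by ring
    have e2 : 2 * (b + 1) = 2 * b + 2 := by ring
    rw [e1, e2]
    push_cast
    linear_combination h'

theorem sum_antidiagonal_of_rec {ψ : ℕ → ℕ → ℤ} (h0 : ∀ a, ψ (a + 1) 0 = ψ a 0)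
    (h1 : ∀ a b, ψ (a + 1) (b + 1) = ψ a (b + 1) + ψ (a + 2) b)
    (a b : ℕ) :
    ∑ i ∈ range (b + 1), ψ (a + i) (b - i) = ψ (a + 1) b := by
  induction b generalizing a with
  | zero => simp [h0]
  | succ b ih =>
    rw [sum_range_succ', h1, ← ih (a + 1), add_comm]
    simp [add_assoc, add_comm 1]

theorem sum_succ_mul_of_rec {ψ : ℕ → ℕ → ℤ} (h0 : ∀ a, ψ (a + 1) 0 = ψ a 0)
    (h1 : ∀ a b, ψ (a + 1) (b + 1) = ψ a (b + 1) + ψ (a + 2) b)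
    (a b : ℕ) :
    ∑ i ∈ range (b + 1), ((i : ℤ) + 1) * ψ (a + i) (b - i) = ψ (a + 2) b := by
  induction b generalizing a with
  | zero => simp [h0]
  | succ b ih =>
    have h := sum_antidiagonal_of_rec h0 h1 a (b + 1)
    simp only [add_mul, one_mul, sum_add_distrib]
    rw [h, sum_range_succ', h1 (a + 1), ← ih (a + 1), add_comm]
    simp [add_assoc, add_comm 1]

theorem ballot_succ_zero (a : ℕ) : ballot (a + 1) 0 = ballot a 0 := by simp [ballot]

theorem ballot_succ_succ (a b : ℕ) :
    ballot (a + 1) (b + 1) = ballot a (b + 1) + ballot (a + 2) b := by rw [ballot]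

theorem ballotDiff_succ_succ (a b : ℕ) :
    ballotDiff (a + 1) (b + 1) = ballotDiff a (b + 1) + ballotDiff (a + 2) b := by
  cases b with
  | zero => simp [ballotDiff, ballot]
  | succ b => simp only [ballotDiff, ballot_succ_succ]; ring

theorem ballot_sum (k a : ℕ) (ha : a ≤ k + 1) :
    (if a = 0 then 0 else ballot (a - 1) (k - (a - 1))) +
      ∑ i ∈ range (k + 1 - a), ballot (a + i) (k - (a + i)) = ballot a (k + 1 - a) := by
  obtain ⟨b, hb⟩ := Nat.exists_eq_add_of_le ha
  have hs : ∑ i ∈ range (k + 1 - a), ballot (a + i) (k - (a + i)) =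
      ∑ i ∈ range b, ballot (a + i) (b - 1 - i) := by
    rw [show k + 1 - a = b by omega]
    exact sum_congr rfl fun i _ => by congr 1; omega
  rw [hs, show k + 1 - a = b by omega]
  cases b with
  | zero =>
    have : a ≠ 0 := by omega
    simp [this, ballot, show k - (a - 1) = 0 by omega]
  | succ b =>
    rw [Nat.add_sub_cancel, sum_antidiagonal_of_rec ballot_succ_zero ballot_succ_succ]
    cases a with
    | zero => simp [ballot]
    | succ a => simp [ballot, show k - a = b + 1 by omega]

theorem ballotDiff_sum (k a : ℕ) (ha : a ≤ k + 2) :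
    (if a = 0 then 0 else ballotDiff (a - 1) (k + 1 - (a - 1))) +
      ∑ i ∈ range (k + 2 - a), ballotDiff (a + i) (k + 1 - (a + i)) =
        ballotDiff a (k + 2 - a) := by
  obtain ⟨b, hb⟩ := Nat.exists_eq_add_of_le ha
  have hs : ∑ i ∈ range (k + 2 - a), ballotDiff (a + i) (k + 1 - (a + i)) =
      ∑ i ∈ range b, ballotDiff (a + i) (b - 1 - i) := by
    rw [show k + 2 - a = b by omega]
    exact sum_congr rfl fun i _ => by congr 1; omega
  rw [hs, show k + 2 - a = b by omega]
  cases b with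
  | zero =>
    have : a ≠ 0 := by omega
    simp [this, ballotDiff, show k + 1 - (a - 1) = 0 by omega]
  | succ b =>
    rw [Nat.add_sub_cancel,
      sum_antidiagonal_of_rec (fun a => by simp [ballotDiff]) ballotDiff_succ_succ]
    cases a with
    | zero =>
      obtain rfl : b = k + 1 := by omega
      cases k <;> simp [ballotDiff, ballot]
    | succ a => simp [ballotDiff_succ_succ, show k + 1 - a = b + 1 by omega]

theorem ballot_pair_sum (k a : ℕ) (ha : a ≤ k + 2) :
    (if a < 2 then 0 else ballot (a - 2) (k - (a - 2))) +
      ∑ i ∈ range (k + 2 - a), ((if a = 0 then 0 else 1) + (i : ℤ)) *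
        ballot (a + i - 1) (k - (a + i - 1)) = ballotDiff a (k + 2 - a) := by
  obtain ⟨b, hb⟩ := Nat.exists_eq_add_of_le ha
  rw [show k + 2 - a = b by omega]
  have hw := sum_succ_mul_of_rec ballot_succ_zero ballot_succ_succ
  cases a with
  | zero =>
    obtain rfl : b = k + 2 := by omega
    rw [sum_range_succ']
    simp only [Nat.zero_add] at *
    have := hw 0 k
    simp only [Nat.zero_add] at this
    simp [this, ballotDiff, ballot]
  | succ a =>
    cases b with
    | zero =>
      have : ¬ a = 0 := by omega
      simp [ballotDiff, this, show k - (a - 1) = 0 by omega, ballot]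
    | succ b =>
      have hs : ∑ i ∈ range (b + 1), ((if a + 1 = 0 then 0 else 1) + (i : ℤ)) *
          ballot (a + 1 + i - 1) (k - (a + 1 + i - 1)) =
          ∑ i ∈ range (b + 1), ((i : ℤ) + 1) * ballot (a + i) (b - i) :=
        sum_congr rfl fun i _ => by
          rw [show a + 1 + i - 1 = a + i by omega, show k - (a + i) = b - i by omega]
          simp [add_comm]
      rw [hs, hw, ballotDiff, ballot_succ_succ]
      cases a with
      | zero => simp [ballot]
      | succ a =>
        rw [ballot_succ_succ]
        simp [show k - a = b + 1 by omega]
        ring_nf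

theorem sum_card_filter_lt {α M : Type*} [LinearOrder α] [AddCommMonoid M] (Q : Finset α)
    (g : ℕ → M) : ∑ x ∈ Q, g #{z ∈ Q | z < x} = ∑ i ∈ range #Q, g i := by
  induction Q using Finset.induction_on_max with
  | empty => simp
  | insert m s hm ih =>
    have hms : m ∉ s := fun h => lt_irrefl _ (hm m h)
    rw [sum_insert hms, card_insert_of_notMem hms, sum_range_succ, ← ih, add_comm]
    congr 1
    · refine sum_congr rfl fun x hx => ?_
      rw [filter_insert, if_neg (hm x hx).le.not_gt]
    · rw [filter_insert, if_neg (lt_irrefl _), filter_true_of_mem hm]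

theorem sum_powersetCard_two {α M : Type*} [LinearOrder α] [AddCommMonoid M] (S : Finset α)
    (c : Finset α → M) :
    ∑ B ∈ S.powersetCard 2, c B = ∑ y ∈ S, ∑ x ∈ S with x < y, c {x, y} := by
  rw [sum_sigma']
  symm
  refine sum_bij (fun p _ => {p.2, p.1}) ?_ ?_ ?_ ?_
  · rintro ⟨y, x⟩ h
    simp only [mem_sigma, mem_filter] at h
    rw [mem_powersetCard]
    refine ⟨?_, card_pair h.2.2.ne⟩
    simp [insert_subset_iff, h.1, h.2.1]
  · rintro ⟨y, x⟩ h ⟨y', x'⟩ h' e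
    simp only [mem_sigma, mem_filter] at h h'
    have e1 : x = x' ∨ x = y' := by
      have : x ∈ ({x, y} : Finset α) := by simp
      rw [e] at this; simpa using this
    have e2 : y = x' ∨ y = y' := by
      have : y ∈ ({x, y} : Finset α) := by simp
      rw [e] at this; simpa using this
    have h1 := h.2.2
    have h2 := h'.2.2
    rcases e1 with rfl | rfl <;> rcases e2 with rfl | rfl <;> simp_all
    exact absurd h1 h2.not_gt
  · intro B hB
    obtain ⟨hs, hc⟩ := mem_powersetCard.1 hB
    obtain ⟨x, y, hxy, rfl⟩ := card_eq_two.1 hc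
    simp only [insert_subset_iff, singleton_subset_iff] at hs
    rcases lt_or_gt_of_ne hxy with h | h
    · exact ⟨⟨y, x⟩, by simp [hs, h], rfl⟩
    · exact ⟨⟨x, y⟩, by simp [hs, h], pair_comm _ _⟩
  · intros; rfl


/-- The sequences of nonempty disjoint blocks with union `S`, avoiding 321, and avoiding it also
when an entry `M` is prepended. -/
structure IsAdmissible {n k : ℕ} (S : Finset (Fin n)) (M : ℕ) (f : Fin k → Finset (Fin n)) :
    Prop where
  nonempty : ∀ i, (f i).Nonempty
  disjoint : ∀ i j, i ≠ j → Disjoint (f i) (f j)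
  mem_iff : ∀ x, x ∈ S ↔ ∃ i, x ∈ f i
  avoid : ∀ i j l, i < j → j < l → ∀ x ∈ f i, ∀ y ∈ f j, ∀ z ∈ f l, z < y → ¬ y < x
  avoid_bound : ∀ i j, i < j → ∀ y ∈ f i, ∀ z ∈ f j, z < y → ¬ y.val < M

open Classical in
/-- The finset of admissible sequences of `k` blocks. -/
noncomputable def admissible {n : ℕ} (k : ℕ) (S : Finset (Fin n)) (M : ℕ) :
    Finset (Fin k → Finset (Fin n)) := {f | IsAdmissible S M f}

/-- The condition on a subset `B` of `S` to be the first block of an admissible sequence. -/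
def IsFirstBlock {n : ℕ} (S : Finset (Fin n)) (M : ℕ) (B : Finset (Fin n)) : Prop :=
  ∀ b ∈ B, b.val < M → ∀ c ∈ S \ B, b < c

theorem isAdmissible_cons {n k : ℕ} {S : Finset (Fin n)} {M : ℕ} {B : Finset (Fin n)}
    {g : Fin k → Finset (Fin n)} :
    IsAdmissible S M (Fin.cons B g : Fin (k + 1) → Finset (Fin n)) ↔
      (B ⊆ S ∧ B.Nonempty ∧ IsFirstBlock S M B) ∧
        IsAdmissible (S \ B) (max M (B.sup Fin.val)) g := by
  constructor
  · rintro ⟨h1, h2, h3, h4, h5⟩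
    simp only [Fin.forall_fin_succ, Fin.exists_fin_succ, Fin.cons_zero, Fin.cons_succ] at *
    have hd : ∀ x i, x ∈ g i → x ∉ B := fun x i hx hB =>
      disjoint_left.1 (h2.1.2 i (Fin.succ_ne_zero i).symm) hB hx
    have hm : ∀ x, x ∈ S \ B ↔ ∃ i, x ∈ g i := fun x => by
      rw [mem_sdiff, h3]
      constructor
      · rintro ⟨h | h, h'⟩
        · exact absurd h h'
        · exact h
      · rintro ⟨i, h⟩
        exact ⟨.inr ⟨i, h⟩, hd x i h⟩
    refine ⟨⟨fun x hx => (h3 x).2 (.inl hx), h1.1, ?_⟩, ⟨h1.2, ?_, hm, ?_, ?_⟩⟩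
    · intro b hb hbM c hc
      obtain ⟨i, hi⟩ := (hm c).1 hc
      by_contra hlt
      have hne : c ≠ b := fun h => hd c i hi (h ▸ hb)
      exact h5.1.2 i (Fin.succ_pos i) b hb c hi (lt_of_le_of_ne (not_lt.1 hlt) hne) hbM
    · intro i j hij
      exact (h2.2 i).2 j (by simpa using hij)
    · intro i j l hij hjl
      exact ((h4.2 i).2 j).2 l (by simpa using hij) (by simpa using hjl)
    · intro i j hij y hy z hz hzy hyM
      rcases lt_max_iff.1 hyM with h | h
      · exact (h5.2 i).2 j (by simpa using hij) y hy z hz hzy h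
      · obtain ⟨x, hx, hyx⟩ := (Finset.lt_sup_iff).1 h
        exact (h4.1.2 i).2 j (Fin.succ_pos i) (by simpa using hij) x hx y hy z hz hzy hyx
  · rintro ⟨⟨hB, hne, hf⟩, h1, h2, h3, h4, h5⟩
    have hd : ∀ i, Disjoint B (g i) := fun i => disjoint_left.2 fun x hx hx' =>
      (mem_sdiff.1 ((h3 x).2 ⟨i, hx'⟩)).2 hx
    constructor
    · simpa [Fin.forall_fin_succ] using ⟨hne, h1⟩
    · simp only [Fin.forall_fin_succ, Fin.cons_zero, Fin.cons_succ]
      refine ⟨⟨by simp, fun i _ => hd i⟩, fun i => ⟨fun _ => (hd i).symm, fun j hij => ?_⟩⟩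
      exact h2 i j (by simpa using hij)
    · intro x
      simp only [Fin.exists_fin_succ, Fin.cons_zero, Fin.cons_succ, ← h3, mem_sdiff]
      have := @hB x
      tauto
    · simp only [Fin.forall_fin_succ, Fin.cons_zero, Fin.cons_succ]
      simp only [lt_self_iff_false, Fin.not_lt_zero, false_implies, implies_true, true_and,
        Fin.succ_lt_succ_iff, Fin.succ_pos, true_implies]
      refine ⟨fun i j hij x hx y hy z hz hzy hyx => ?_, fun i j l hij hjl => h4 i j l hij hjl⟩
      exact h5 i j hij y hy z hz hzy (lt_max_iff.2 (.inr (Finset.lt_sup_iff.2 ⟨x, hx, hyx⟩)))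
    · simp only [Fin.forall_fin_succ, Fin.cons_zero, Fin.cons_succ]
      simp only [lt_self_iff_false, Fin.not_lt_zero, false_implies, true_and,
        Fin.succ_lt_succ_iff, Fin.succ_pos, true_implies]
      refine ⟨fun i y hy z hz hzy hyM => ?_, fun i j hij y hy z hz hzy hyM => ?_⟩
      · exact (hf y hy hyM z ((h3 z).2 ⟨i, hz⟩)).not_gt hzy
      · exact h5 i j hij y hy z hz hzy (lt_max_iff.2 (.inl hyM))

open Classical in
theorem card_admissible_succ {n : ℕ} (k : ℕ) (S : Finset (Fin n)) (M : ℕ) :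
    #(admissible (k + 1) S M) = ∑ B ∈ S.powerset, if B.Nonempty ∧ IsFirstBlock S M B then
      #(admissible k (S \ B) (max M (B.sup Fin.val))) else 0 := by
  rw [card_eq_sum_card_fiberwise (f := fun f => f 0) (t := S.powerset)]
  · refine sum_congr rfl fun B hB => ?_
    rw [mem_powerset] at hB
    split_ifs with h
    · refine card_nbij' (fun f => Fin.tail f) (fun g => Fin.cons B g) ?_ ?_ ?_ ?_
      · intro f hf
        simp only [admissible, mem_coe, mem_filter, mem_univ, true_and] at hf ⊢
        obtain ⟨hf, rfl⟩ := hf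
        rw [← Fin.cons_self_tail f] at hf
        exact (isAdmissible_cons.1 hf).2
      · intro g hg
        simp only [admissible, mem_coe, mem_filter, mem_univ, true_and] at hg ⊢
        exact ⟨isAdmissible_cons.2 ⟨⟨hB, h.1, h.2⟩, hg⟩, rfl⟩
      · intro f hf
        obtain rfl := (mem_filter.1 hf).2
        exact Fin.cons_self_tail f
      · intro g _
        exact Fin.tail_cons _ _
    · rw [card_eq_zero, filter_eq_empty_iff]
      rintro f hf rfl
      simp only [admissible, mem_filter, mem_univ, true_and] at hf
      rw [← Fin.cons_self_tail f] at hf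
      exact h (isAdmissible_cons.1 hf).1.2
  · intro f hf
    simp only [admissible, mem_coe, mem_filter, mem_univ, true_and] at hf
    rw [← Fin.cons_self_tail f] at hf
    exact mem_powerset.2 (isAdmissible_cons.1 hf).1.1

theorem card_admissible_zero {n : ℕ} (S : Finset (Fin n)) (M : ℕ) :
    #(admissible 0 S M) = if #S = 0 then 1 else 0 := by
  classical
  have : ∀ f : Fin 0 → Finset (Fin n), IsAdmissible S M f ↔ #S = 0 := fun f => by
    rw [card_eq_zero, eq_empty_iff_forall_notMem]
    constructor
    · intro h x hx
      obtain ⟨i, _⟩ := (h.mem_iff x).1 hx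
      exact i.elim0
    · intro h
      exact ⟨fun i => i.elim0, fun i => i.elim0, fun x => by simp [h x], fun i => i.elim0,
        fun i => i.elim0⟩
  simp only [admissible, this]
  split_ifs with h <;> simp [h]

theorem card_admissible_of_card_lt {n : ℕ} (k : ℕ) (S : Finset (Fin n)) (M : ℕ) (h : #S < k) :
    #(admissible k S M) = 0 := by
  classical
  induction k generalizing S M with
  | zero => omega
  | succ k ih =>
    rw [card_admissible_succ]
    refine sum_eq_zero fun B hB => ?_
    split_ifs with hB'
    · refine ih _ _ ?_
      have := card_sdiff_add_card_eq_card (mem_powerset.1 hB)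
      have := hB'.1.card_pos
      omega
    · rfl

/-- The number of elements of `S` with value less than `M`. -/
def below {n : ℕ} (S : Finset (Fin n)) (M : ℕ) : ℕ := #{z ∈ S | z.val < M}

section FirstBlock

variable {n : ℕ} {S : Finset (Fin n)} {M : ℕ}

theorem below_le_card : below S M ≤ #S := card_filter_le _ _

theorem card_filter_not_lt : #{z ∈ S | ¬ z.val < M} = #S - below S M := by
  have := card_filter_add_card_filter_not (s := S) (fun z => z.val < M)
  unfold below
  omega

theorem card_filter_lt_of_le {y : Fin n} (hy : M ≤ y.val) :
    #{z ∈ S | z < y} = below S M + #{z ∈ {z ∈ S | ¬ z.val < M} | z < y} := by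
  rw [← card_filter_add_card_filter_not (s := {z ∈ S | z < y}) (fun z => z.val < M), below,
    filter_filter, filter_filter, filter_filter]
  congr 2
  · ext z
    simp only [mem_filter, Fin.lt_def]
    constructor <;> intro h <;> refine ⟨h.1, ?_⟩ <;> omega
  · ext z
    simp only [mem_filter, and_comm]

theorem below_sdiff_of_subset {B : Finset (Fin n)} (hB : B ⊆ {z ∈ S | z.val < M}) :
    below (S \ B) M = below S M - #B := by
  rw [below, below, ← card_sdiff_of_subset hB]
  congr 1
  ext z
  simp only [mem_filter, mem_sdiff]
  tauto

theorem isFirstBlock_singleton_iff {x : Fin n} (hM : x.val < M) :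
    IsFirstBlock S M {x} ↔ #{z ∈ {z ∈ S | z.val < M} | z < x} = 0 := by
  simp only [IsFirstBlock, card_eq_zero, filter_eq_empty_iff, mem_singleton, forall_eq, mem_sdiff,
    mem_filter, hM, true_implies]
  constructor
  · intro h z hz hzx
    exact (h z ⟨hz.1, hzx.ne⟩).not_gt hzx
  · intro h c hc
    by_contra hlt
    have hlt' : c < x := lt_of_le_of_ne (not_lt.1 hlt) hc.2
    exact h ⟨hc.1, lt_trans (Fin.lt_def.1 hlt') hM⟩ hlt'

theorem isFirstBlock_of_le {B : Finset (Fin n)} (h : ∀ b ∈ B, M ≤ b.val) : IsFirstBlock S M B :=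
  fun b hb hM => absurd hM (h b hb).not_gt

theorem isFirstBlock_pair_iff_of_lt {x y : Fin n} (hx : x ∈ S) (hxy : x < y)
    (hM : y.val < M) :
    IsFirstBlock S M {x, y} ↔ #{z ∈ {z ∈ S | z.val < M} | z < y} = 1 := by
  have hxM : x.val < M := lt_trans (Fin.lt_def.1 hxy) hM
  have hxm : x ∈ ({z ∈ {z ∈ S | z.val < M} | z < y} : Finset (Fin n)) := by
    simp [hx, hxM, hxy]
  constructor
  · intro h
    rw [card_eq_one]
    refine ⟨x, eq_singleton_iff_unique_mem.2 ⟨hxm, fun z hz => ?_⟩⟩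
    simp only [mem_filter] at hz
    by_contra hne
    have := h y (by simp) hM z (by simp [hz.1.1, hne, hz.2.ne])
    exact this.not_gt hz.2
  · intro h
    obtain ⟨w, hw⟩ := card_eq_one.1 h
    obtain rfl : x = w := by simpa [hw] using hxm
    have key : ∀ c ∈ S \ {x, y}, y < c := fun c hc => by
      simp only [mem_sdiff, mem_insert, mem_singleton, not_or] at hc
      by_contra hlt
      have hlt' : c < y := lt_of_le_of_ne (not_lt.1 hlt) hc.2.2
      have : c ∈ ({x} : Finset (Fin n)) := by
        rw [← hw]
        simp [hc.1, hlt', lt_trans (Fin.lt_def.1 hlt') hM]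
      exact hc.2.1 (by simpa using this)
    intro b hb _ c hc
    rcases mem_insert.1 hb with rfl | hb
    · exact hxy.trans (key c hc)
    · rw [mem_singleton.1 hb]
      exact key c hc

theorem isFirstBlock_pair_iff_of_le {x y : Fin n} (hxy : x < y) (hxM : x.val < M)
    (hM : M ≤ y.val) : IsFirstBlock S M {x, y} ↔ IsFirstBlock S M {x} := by
  constructor
  · intro h b hb hbM c hc
    obtain rfl := mem_singleton.1 hb
    by_cases hcy : c = y
    · exact hcy ▸ hxy
    · refine h b (by simp) hbM c ?_
      simp only [mem_sdiff, mem_singleton, mem_insert, not_or] at hc ⊢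
      exact ⟨hc.1, hc.2, hcy⟩
  · intro h b hb hbM c hc
    simp only [mem_sdiff, mem_insert, mem_singleton, not_or] at hb hc
    rcases hb with rfl | rfl
    · exact h b (by simp) hbM c (by simp [hc])
    · omega

theorem below_sdiff_pair {x y : Fin n} (hx : x ∈ S) (hxy : x < y) (hM : M ≤ y.val) :
    below (S \ {x, y}) (max M (({x, y} : Finset (Fin n)).sup Fin.val)) =
      below S M + #{z ∈ {z ∈ S | ¬ z.val < M} | z < y} - 1 := by
  rw [← card_filter_lt_of_le hM, below]
  have hm : max M (({x, y} : Finset (Fin n)).sup Fin.val) = y.val := by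
    simp only [sup_insert, sup_singleton]
    rw [Fin.lt_def] at hxy
    omega
  rw [hm, ← card_singleton x, ← card_sdiff_of_subset (by simp [hx, hxy])]
  congr 1
  ext z
  simp only [mem_filter, mem_sdiff, mem_insert, mem_singleton, Fin.lt_def, Fin.ext_iff]
  constructor <;> intro h <;> refine ⟨⟨h.1.1, ?_⟩, ?_⟩ <;> omega

open Classical in
theorem sum_singleton_firstBlock (φ : ℕ → ℤ) :
    ∑ x ∈ S, (if IsFirstBlock S M {x} then
      φ (below (S \ {x}) (max M (({x} : Finset (Fin n)).sup Fin.val))) else 0) =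
    (if below S M = 0 then 0 else φ (below S M - 1)) +
      ∑ i ∈ range (#S - below S M), φ (below S M + i) := by
  rw [← sum_filter_add_sum_filter_not S (fun x => x.val < M)]
  congr 1
  · trans ∑ x ∈ S with x.val < M, (fun i => if i = 0 then φ (below S M - 1) else 0)
        #{z ∈ {z ∈ S | z.val < M} | z < x}
    · refine sum_congr rfl fun x hx => ?_
      have hx' := mem_filter.1 hx
      rw [isFirstBlock_singleton_iff hx'.2, sup_singleton, max_eq_left hx'.2.le,
        below_sdiff_of_subset (by simpa using hx'), card_singleton]
      beta_reduce
      split_ifs <;> rfl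
    · refine (sum_card_filter_lt _ fun i => if i = 0 then φ (below S M - 1) else 0).trans ?_
      rw [← below, sum_ite_eq' (range _) 0 fun _ => _]
      by_cases h : below S M = 0 <;> simp [h, Nat.pos_iff_ne_zero]
  · rw [← card_filter_not_lt, ← sum_card_filter_lt]
    refine sum_congr rfl fun x hx => ?_
    have hx' := mem_filter.1 hx
    rw [if_pos (isFirstBlock_of_le (by simpa using hx'.2)), ← card_filter_lt_of_le (by omega),
      sup_singleton, max_eq_right (by omega), below]
    congr 2
    ext z
    simp only [mem_filter, mem_sdiff, mem_singleton, Fin.lt_def, Fin.ext_iff]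
    constructor <;> intro h
    · exact ⟨h.1.1, h.2⟩
    · exact ⟨⟨h.1, by omega⟩, h.2⟩

open Classical in
theorem sum_pair_firstBlock (φ : ℕ → ℤ) :
    ∑ B ∈ S.powersetCard 2, (if IsFirstBlock S M B then
      φ (below (S \ B) (max M (B.sup Fin.val))) else 0) =
    (if below S M < 2 then 0 else φ (below S M - 2)) +
      ∑ i ∈ range (#S - below S M), ((if below S M = 0 then 0 else 1) + (i : ℤ)) *
        φ (below S M + i - 1) := by
  rw [sum_powersetCard_two, ← sum_filter_add_sum_filter_not S (fun y => y.val < M)]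
  congr 1
  · trans ∑ y ∈ S with y.val < M, (fun i => if i = 1 then φ (below S M - 2) else 0)
        #{z ∈ {z ∈ S | z.val < M} | z < y}
    · refine sum_congr rfl fun y hy => ?_
      have hy' := mem_filter.1 hy
      have hf : ({x ∈ S | x < y} : Finset (Fin n)) = {z ∈ {z ∈ S | z.val < M} | z < y} := by
        ext z
        simp only [mem_filter, Fin.lt_def]
        constructor
        · exact fun h => ⟨⟨h.1, by omega⟩, h.2⟩
        · exact fun h => ⟨h.1.1, h.2⟩
      rw [hf]
      trans ∑ x ∈ {z ∈ {z ∈ S | z.val < M} | z < y},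
        if #{z ∈ {z ∈ S | z.val < M} | z < y} = 1 then φ (below S M - 2) else 0
      · refine sum_congr rfl fun x hx => ?_
        have hx' := mem_filter.1 hx
        have hx'' := mem_filter.1 hx'.1
        have hm : max M (({x, y} : Finset (Fin n)).sup Fin.val) = M := by
          simp only [sup_insert, sup_singleton]
          omega
        rw [isFirstBlock_pair_iff_of_lt hx''.1 hx'.2 hy'.2, hm,
          below_sdiff_of_subset (by simp [insert_subset_iff, hx'', hy']),
          card_pair hx'.2.ne]
        split_ifs <;> rfl
      · rw [sum_const]
        split_ifs with h <;> simp [h]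
    · refine (sum_card_filter_lt _ fun i => if i = 1 then φ (below S M - 2) else 0).trans ?_
      rw [← below, sum_ite_eq' (range _) 1 fun _ => _]
      by_cases h : below S M < 2
      · rw [if_pos h, if_neg (by simpa using by omega)]
      · rw [if_neg h, if_pos (by simpa using by omega)]
  · rw [← card_filter_not_lt, ← sum_card_filter_lt _ (fun i =>
      ((if below S M = 0 then 0 else 1) + (i : ℤ)) * φ (below S M + i - 1))]
    refine sum_congr rfl fun y hy => ?_
    have hy' := mem_filter.1 hy
    have hyM : M ≤ y.val := by omega
    rw [add_mul, ← sum_filter_add_sum_filter_not {x ∈ S | x < y} (fun x => x.val < M)]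
    congr 1
    · have hf : ({x ∈ {x ∈ S | x < y} | x.val < M} : Finset (Fin n)) = {z ∈ S | z.val < M} := by
        ext z
        simp only [mem_filter, Fin.lt_def]
        constructor
        · exact fun h => ⟨h.1.1, h.2⟩
        · exact fun h => ⟨⟨h.1, by omega⟩, h.2⟩
      rw [hf]
      trans ∑ x ∈ S with x.val < M, (fun i => if i = 0 then
          φ (below S M + #{z ∈ {z ∈ S | ¬ z.val < M} | z < y} - 1) else 0)
          #{z ∈ {z ∈ S | z.val < M} | z < x}
      · refine sum_congr rfl fun x hx => ?_
        have hx' := mem_filter.1 hx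
        have hxy : x < y := Fin.lt_def.2 (by omega)
        rw [isFirstBlock_pair_iff_of_le hxy hx'.2 hyM, isFirstBlock_singleton_iff hx'.2,
          below_sdiff_pair hx'.1 hxy hyM]
        beta_reduce
        split_ifs <;> rfl
      · refine (sum_card_filter_lt _ fun i => if i = 0 then
          φ (below S M + #{z ∈ {z ∈ S | ¬ z.val < M} | z < y} - 1) else 0).trans ?_
        rw [← below, sum_ite_eq' (range _) 0 fun _ => _]
        by_cases h : below S M = 0 <;> simp [h, Nat.pos_iff_ne_zero]
    · have hf : ({x ∈ {x ∈ S | x < y} | ¬ x.val < M} : Finset (Fin n)) =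
          {z ∈ {z ∈ S | ¬ z.val < M} | z < y} := by
        rw [filter_filter, filter_filter]
        simp only [and_comm]
      rw [hf, ← nsmul_eq_mul, ← sum_const]
      refine sum_congr rfl fun x hx => ?_
      simp only [mem_filter] at hx
      rw [below_sdiff_pair hx.1.1 hx.2 hyM, if_pos]
      refine isFirstBlock_of_le fun b hb => ?_
      rcases mem_insert.1 hb with rfl | hb
      · omega
      · rw [mem_singleton.1 hb]
        exact hyM

end FirstBlock

open Classical in
theorem card_admissible_of_card_eq {n : ℕ} (k : ℕ) (S : Finset (Fin n)) (M : ℕ) (h : #S = k) :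
    (#(admissible k S M) : ℤ) = ballot (below S M) (k - below S M) := by
  induction k generalizing S M with
  | zero => simp [card_admissible_zero, h, ballot]
  | succ k ih =>
    rw [card_admissible_succ, sum_powerset, h, sum_range_succ', sum_range_succ']
    rw [sum_eq_zero]
    · rw [← ballot_sum k _ (h ▸ below_le_card), ← h, ← sum_singleton_firstBlock
        fun s => ballot s (k - s)]
      simp only [zero_add, powersetCard_one, sum_map, powersetCard_zero, sum_singleton,
        Function.Embedding.coeFn_mk, singleton_nonempty, true_and, Finset.not_nonempty_empty, false_and,
        if_false, add_zero]
      push_cast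
      refine sum_congr rfl fun x hx => ?_
      split_ifs
      · refine ih _ _ ?_
        rw [card_sdiff_of_subset (by simpa using hx), h]
        simp
      · rfl
    · intro i hi
      refine sum_eq_zero fun B hB => ?_
      obtain ⟨hB, hc⟩ := mem_powersetCard.1 hB
      rw [card_admissible_of_card_lt, ite_self]
      rw [card_sdiff_of_subset hB]
      have := mem_range.1 hi
      omega

open Classical in
theorem card_admissible_of_card_eq_succ {n : ℕ} (k : ℕ) (S : Finset (Fin n)) (M : ℕ)
    (h : #S = k + 1) :
    (#(admissible k S M) : ℤ) = k * ballotDiff (below S M) (k + 1 - below S M) := by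
  induction k generalizing S M with
  | zero => simp [card_admissible_zero, h]
  | succ k ih =>
    rw [card_admissible_succ, sum_powerset, h, sum_range_succ', sum_range_succ', sum_range_succ']
    rw [sum_eq_zero]
    · have e1 := sum_singleton_firstBlock (S := S) (M := M)
        fun s => k * ballotDiff s (k + 1 - s)
      have e2 := sum_pair_firstBlock (S := S) (M := M) fun s => ballot s (k - s)
      have hle : below S M ≤ k + 2 := h ▸ below_le_card
      rw [h, ballot_pair_sum k _ hle] at e2
      have hk := congrArg (fun t => (k : ℤ) * t) (ballotDiff_sum k _ hle)
      simp only [mul_add, mul_ite, mul_zero, mul_sum] at hk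
      rw [h] at e1
      replace e1 := e1.trans hk
      have : ((k + 1 : ℕ) : ℤ) * ballotDiff (below S M) (k + 1 + 1 - below S M) =
        ballotDiff (below S M) (k + 2 - below S M) +
          k * ballotDiff (below S M) (k + 2 - below S M) := by push_cast; ring
      rw [this, ← e1, ← e2]
      simp only [zero_add, powersetCard_one, sum_map, powersetCard_zero, sum_singleton,
        Function.Embedding.coeFn_mk, singleton_nonempty, true_and, Finset.not_nonempty_empty, false_and,
        if_false, add_zero]
      push_cast
      congr 1
      · refine sum_congr rfl fun B hB => ?_
        obtain ⟨hB, hc⟩ := mem_powersetCard.1 hB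
        have hne : B.Nonempty := card_pos.1 (by omega)
        simp only [hne, true_and]
        split_ifs
        · refine card_admissible_of_card_eq _ _ _ ?_
          rw [card_sdiff_of_subset hB]
          omega
        · rfl
      · refine sum_congr rfl fun x hx => ?_
        split_ifs
        · refine ih _ _ ?_
          rw [card_sdiff_of_subset (by simpa using hx), h]
          simp
        · rfl
    · intro i hi
      refine sum_eq_zero fun B hB => ?_
      obtain ⟨hB, hc⟩ := mem_powersetCard.1 hB
      rw [card_admissible_of_card_lt, ite_self]
      rw [card_sdiff_of_subset hB]
      have := mem_range.1 hi
      omega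

theorem opContains_p321_iff {n k : ℕ} (P : OrdPartition n k) : OPContains P p321 ↔
    ∃ i j l, i < j ∧ j < l ∧ ∃ x ∈ P.blocks i, ∃ y ∈ P.blocks j, ∃ z ∈ P.blocks l,
      z < y ∧ y < x := by
  constructor
  · rintro ⟨ι, hι, b, hb, h⟩
    refine ⟨ι 0, ι 1, ι 2, hι (by decide), hι (by decide), b 0, hb 0, b 1, hb 1, b 2, hb 2,
      (h 2 1).2 (by decide), (h 1 0).2 (by decide)⟩
  · rintro ⟨i, j, l, hij, hjl, x, hx, y, hy, z, hz, hzy, hyx⟩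
    have hzx := hzy.trans hyx
    refine ⟨![i, j, l], ?_, ![x, y, z], ?_, ?_⟩
    · rw [Fin.strictMono_iff_lt_succ]
      intro a
      fin_cases a
      · exact hij
      · exact hjl
    · intro a
      fin_cases a
      · exact hx
      · exact hy
      · exact hz
    · intro a c
      rw [p321, Fin.revPerm_apply, Fin.revPerm_apply, Fin.rev_lt_rev]
      fin_cases a <;> fin_cases c <;> simp [hzy, hyx, hzx, hzy.le, hyx.le, hzx.le]

theorem opAvoidCount_p321 (n k : ℕ) :
    opAvoidCount n k 3 p321 = #(admissible k (univ : Finset (Fin n)) 0) := by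
  rw [opAvoidCount, ← Fintype.card_coe, ← Nat.card_eq_fintype_card]
  refine Nat.card_congr ⟨fun P => ⟨P.1.blocks, ?_⟩, fun f => ⟨⟨f.1, ?_, ?_, ?_⟩, ?_⟩,
    fun _ => rfl, fun _ => rfl⟩
  · obtain ⟨P, hP⟩ := P
    rw [opContains_p321_iff] at hP
    push Not at hP
    simp only [admissible, mem_filter, mem_univ, true_and]
    exact ⟨P.blocks_nonempty, P.blocks_disjoint, fun x => by simp [P.blocks_cover x],
      fun i j l hij hjl x hx y hy z hz hzy => (hP i j l hij hjl x hx y hy z hz hzy).not_gt,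
      fun _ _ _ _ _ _ _ _ => Nat.not_lt_zero _⟩
  all_goals
    obtain ⟨f, hf⟩ := f
    simp only [admissible, mem_filter, mem_univ, true_and] at hf
  · exact hf.nonempty
  · exact hf.disjoint
  · exact fun x => (hf.mem_iff x).1 (mem_univ x)
  · rw [opContains_p321_iff]
    rintro ⟨i, j, l, hij, hjl, x, hx, y, hy, z, hz, hzy, hyx⟩
    exact hf.avoid i j l hij hjl x hx y hy z hz hzy hyx

theorem op_subdiagonal_321 (n : ℕ) (hn : 1 ≤ n) :
    (opAvoidCount n (n - 1) 3 p321 : ℚ) =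
      3 * ((n : ℚ) - 1) ^ 2 / ((n : ℚ) * ((n : ℚ) + 1)) * Nat.choose (2 * n - 2) (n - 1) := by
  obtain ⟨m, rfl⟩ := Nat.exists_eq_add_of_le' hn
  have h := card_admissible_of_card_eq_succ m (univ : Finset (Fin (m + 1))) 0 (by simp)
  have hb : below (univ : Finset (Fin (m + 1))) 0 = 0 := by simp [below]
  rw [hb, Nat.sub_zero, ballotDiff, ← opAvoidCount_p321] at h
  have h1 := succ_mul_ballot_zero m
  have h2 := succ_mul_ballot_zero (m + 1)
  have h3 := Nat.succ_mul_centralBinom_succ m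
  rw [← Nat.centralBinom_eq_two_mul_choose] at h1 h2
  rw [show 2 * (m + 1) - 2 = 2 * m by omega, Nat.add_sub_cancel,
    ← Nat.centralBinom_eq_two_mul_choose]
  have h' : (opAvoidCount (m + 1) m 3 p321 : ℚ) = m * (ballot 0 (m + 1) - ballot 0 m) := by
    exact_mod_cast h
  have h1' : ((m : ℚ) + 1) * ballot 0 m = Nat.centralBinom m := by exact_mod_cast h1
  have h2' : ((m : ℚ) + 1 + 1) * ballot 0 (m + 1) = Nat.centralBinom (m + 1) := by
    exact_mod_cast h2
  have h3' : ((m : ℚ) + 1) * Nat.centralBinom (m + 1) = 2 * (2 * m + 1) * Nat.centralBinom m := by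
    exact_mod_cast h3
  rw [h']
  push_cast
  field_simp
  linear_combination (m : ℚ) * (m + 1) * h2' + m * h3' - (m : ℚ) * (m + 2) * h1'
end

section
/- For all integers n (with the convention op_{m,k}(321) = 0 if m < k or k < 0 or m < 0, and op_{m,0}(321) = δ_{m,0}) and all k ≥ 0: (n+4)·op_{n+3,k+1}(321) = (5n+14)·op_{n+2,k+1}(321) + (4n+10)·op_{n+2,k}(321) - (8n+14)·(op_{n+1,k+1}(321) + op_{n+1,k}(321)) + (4n+4)·(op_{n,k+1}(321) + op_{n,k}(321)). -/
open Finset BigOperators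

/-- `op_{n,k}(321)` extended to all integers `n`, `k` with the conventions
`op_{n,k} = 0` if `n < k` or `k < 0` or `n < 0`, and `op_{n,0} = δ_{n,0}`. -/
noncomputable def opExt (n k : ℤ) : ℤ :=
  if 0 ≤ n ∧ 0 ≤ k then (opAvoidCount n.toNat k.toNat 3 p321 : ℤ) else 0

namespace PowerSeries

/-- The generating function `∑ W(n, k + 1) u ^ k x ^ n` of the numbers of `321`-avoiding words,
as a power series in `x` over `ℤ⟦u⟧`. It is a rescaled Catalan series. -/
noncomputable def wordSeries : ℤ⟦X⟧⟦X⟧ :=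
  C (mk 1) * (catalanSeries.map (Nat.castRingHom ℤ)).subst
    (C (mk 1) * (X * (1 - X)) : ℤ⟦X⟧⟦X⟧)

theorem one_sub_C_X_mul_C_mk_one : (1 - C X) * C (mk 1) = (1 : ℤ⟦X⟧⟦X⟧) := by
  have h := congrArg (C (R := ℤ⟦X⟧)) (mk_one_mul_one_sub_eq_one ℤ)
  simp only [map_mul, map_sub, map_one] at h
  rw [mul_comm, h]

theorem one_sub_C_X_mul_wordSeries :
    (1 - C X) * wordSeries = 1 + X * (1 - X) * (1 - C X) * wordSeries ^ 2 := by
  have hb : HasSubst (C (mk 1) * (X * (1 - X)) : ℤ⟦X⟧⟦X⟧) :=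
    HasSubst.of_constantCoeff_zero' (by simp)
  have h := congrArg (map (Nat.castRingHom ℤ)) catalanSeries_sq_mul_X_add_one
  simp only [map_add, map_mul, map_pow, map_X, map_one] at h
  have h2 := congrArg (substAlgHom (R := ℤ) hb) h
  simp only [map_add, map_mul, map_pow, map_one] at h2
  simp only [coe_substAlgHom, subst_X hb] at h2
  have h1 := one_sub_C_X_mul_C_mk_one
  unfold wordSeries
  set c := subst (C (mk 1) * (X * (1 - X)) : ℤ⟦X⟧⟦X⟧) (map (Nat.castRingHom ℤ) catalanSeries)
  linear_combination (c - X * (1 - X) * C (mk 1) * c ^ 2) * h1 - h2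

theorem constantCoeff_wordSeries : constantCoeff wordSeries = (mk 1 : ℤ⟦X⟧) := by
  have h := congrArg constantCoeff one_sub_C_X_mul_wordSeries
  simp only [map_add, map_mul, map_sub, map_one, constantCoeff_C, constantCoeff_X, zero_mul,
    add_zero] at h
  linear_combination (mk 1) * h - constantCoeff wordSeries * mk_one_mul_one_sub_eq_one ℤ

/-- A first-order linear differential equation for `wordSeries`. -/
theorem derivative_wordSeries :
    (1 - C X) * (X * d⁄dX _ wordSeries + wordSeries) =
      5 * X * (X * d⁄dX _ wordSeries) + 4 * X * wordSeries
        - C X * (X * (X * d⁄dX _ wordSeries) + 2 * X * wordSeries)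
        - X ^ 2 * (8 * (X * d⁄dX _ wordSeries) + 6 * wordSeries)
        + X ^ 3 * (4 * (X * d⁄dX _ wordSeries) + 4 * wordSeries) + 1 - 2 * X := by
  have h := one_sub_C_X_mul_wordSeries
  have hd := congrArg (d⁄dX _) h
  simp only [Derivation.leibniz, Derivation.leibniz_pow, map_add, map_sub, derivative_C,
    derivative_one, derivative_X, smul_eq_mul, nsmul_eq_mul] at hd
  push_cast at hd
  ring_nf at hd
  set y := wordSeries
  set z := d⁄dX _ y
  have hz : (1 - C X - 4 * (X * (1 - X))) * z = (1 - 2 * X) * (2 * y - (1 - C X) * y ^ 2) := by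
    linear_combination (1 - 2 * (X * (1 - X)) * y) * hd
      + (4 * (X * (1 - X)) * z + 2 * y * (1 - 2 * X)) * h
  linear_combination X * (1 - X) * hz + (1 - 2 * X) * h

/-- The ratio of the generating functions for consecutive values of the catalytic parameter. -/
theorem exists_wordSeries_ratio : ∃ T : ℤ⟦X⟧⟦X⟧, constantCoeff T = 1 ∧
    (1 - X) * wordSeries * (1 - C X * T) = 1 ∧
    (T - 1) * (1 - C X * T) = X * (T - 1) + X * T * (1 - C X * T) := by
  have h := one_sub_C_X_mul_wordSeries
  set y := wordSeries
  have hu : IsUnit (1 - X - X * ((1 - X) * y)) := by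
    rw [isUnit_iff_constantCoeff]; simp
  obtain ⟨v, hv⟩ := hu.exists_left_inv
  have h1 : (1 - X) * y * (1 - C X * (v * (1 - X * ((1 - X) * y)))) = 1 := by
    linear_combination (- (1 - X) * y + 1 ) * hv + v * (1 - X) * h
  refine ⟨v * (1 - X * ((1 - X) * y)), ?_, h1, ?_⟩
  · have := congrArg constantCoeff hv
    simpa using this
  · generalize hT : v * (1 - X * ((1 - X) * y)) = T at *
    have h2 : T * (1 - X - X * ((1 - X) * y)) = 1 - X * ((1 - X) * y) := by
      rw [← hT]; linear_combination (1 - X * ((1 - X) * y)) * hv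
    linear_combination (1 - C X * T) * h2 + X * (T - 1) * h1

/-- The generating function by length of the completions of a `321`-avoiding word over an alphabet
with `d` letters between the last non-maximal letter and the maximum. -/
noncomputable def completionSeries (d : ℕ) : ℤ⟦X⟧⟦X⟧ :=
  wordSeries * exists_wordSeries_ratio.choose ^ d

theorem completionSeries_sub (d : ℕ) :
    completionSeries d - C X * completionSeries (d + 1) =
      1 + X * (completionSeries d + ∑ j ∈ range d, completionSeries (j + 1)
        - C X * ∑ j ∈ range (d + 1), completionSeries (j + 1)) := by
  obtain ⟨-, h1, h2⟩ := exists_wordSeries_ratio.choose_spec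
  unfold completionSeries
  generalize exists_wordSeries_ratio.choose = T at *
  induction d with
  | zero => simp; linear_combination h1
  | succ d ih =>
    rw [sum_range_succ _ (d + 1)]
    nth_rewrite 1 [sum_range_succ]
    linear_combination ih + wordSeries * T ^ d * h2

theorem coeff_zero_coeff_C_X_mul (n : ℕ) (f : ℤ⟦X⟧⟦X⟧) : coeff 0 (coeff n (C X * f)) = 0 := by
  simp [coeff_C_mul]

theorem coeff_succ_coeff_C_X_mul (n a : ℕ) (f : ℤ⟦X⟧⟦X⟧) :
    coeff (a + 1) (coeff n (C X * f)) = coeff a (coeff n f) := by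
  simp [coeff_C_mul, coeff_succ_X_mul]

theorem coeff_coeff_zero_completionSeries (a d : ℕ) :
    coeff a (coeff 0 (completionSeries d)) = 1 := by
  obtain ⟨h0, -, -⟩ := exists_wordSeries_ratio.choose_spec
  simp [completionSeries, h0, constantCoeff_wordSeries]

theorem coeff_coeff_succ_completionSeries (n a d : ℕ) :
    coeff a (coeff (n + 1) (completionSeries d)) =
      ∑ i ∈ range (a + 1), coeff (a - i) (coeff n (completionSeries (d + i)))
        + ∑ j ∈ range d, coeff a (coeff n (completionSeries (j + 1))) := by
  induction a generalizing d with
  | zero =>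
    have h := congrArg (fun f => coeff 0 (coeff (n + 1) f)) (completionSeries_sub d)
    simp only [map_add, map_sub, coeff_zero_coeff_C_X_mul, coeff_succ_X_mul, coeff_one,
      map_sum] at h
    simpa using h
  | succ a ih =>
    have h := congrArg (fun f => coeff (a + 1) (coeff (n + 1) f)) (completionSeries_sub d)
    simp only [map_add, map_sub, coeff_succ_coeff_C_X_mul, coeff_succ_X_mul, coeff_one,
      map_sum, ih] at h
    rw [sum_range_succ' _ (a + 1)]
    simp only [Nat.add_sub_add_right, add_zero, Nat.sub_zero, ← add_assoc,
      add_right_comm _ 1] at h ⊢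
    simp at h
    linear_combination h

end PowerSeries

section Pattern

variable {n k l m : ℕ}

theorem wordContains_comp_iff {e : Fin l → Fin k} (he : StrictMono e) (w : Fin n → Fin l)
    (p : Equiv.Perm (Fin m)) : WordContains (e ∘ w) p ↔ WordContains w p := by
  simp only [WordContains, Function.comp_apply, he.lt_iff_lt]

theorem wordContains_p321_iff (w : Fin n → Fin k) :
    WordContains w p321 ↔ ∃ i j l, i < j ∧ j < l ∧ w j < w i ∧ w l < w j := by
  constructor
  · rintro ⟨ι, hι, h⟩
    exact ⟨ι 0, ι 1, ι 2, hι (by decide), hι (by decide), (h 1 0).2 (by decide),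
      (h 2 1).2 (by decide)⟩
  · rintro ⟨i, j, l, hij, hjl, h1, h2⟩
    refine ⟨![i, j, l], ?_, ?_⟩
    · intro a b hab
      fin_cases a <;> fin_cases b <;> simp_all
      exact hij.trans hjl
    · intro a b
      fin_cases a <;> fin_cases b <;>
        simp [p321, h1, h2, h1.le, h2.le, h2.trans h1, (h2.trans h1).le]

/-- Ordered set partitions are the same as surjective words: the letter at position `x` is the
index of the block containing `x`. -/
noncomputable def OrdPartition.equivSurjective (n k : ℕ) :
    OrdPartition n k ≃ {f : Fin n → Fin k // Function.Surjective f} where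
  toFun P := ⟨fun x => (P.blocks_cover x).choose, fun i => by
    obtain ⟨x, hx⟩ := P.blocks_nonempty i
    refine ⟨x, ?_⟩
    by_contra h
    exact Finset.disjoint_left.1 (P.blocks_disjoint _ _ h) (P.blocks_cover x).choose_spec hx⟩
  invFun f :=
    { blocks := fun i => {x | f.1 x = i}
      blocks_nonempty := fun i => by
        obtain ⟨x, hx⟩ := f.2 i
        exact ⟨x, by simpa using hx⟩
      blocks_disjoint := fun i j h => by
        rw [Finset.disjoint_left]
        intro x hx hx'
        simp only [mem_filter, mem_univ, true_and] at hx hx'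
        exact h (hx.symm.trans hx')
      blocks_cover := fun x => ⟨f.1 x, by simp⟩ }
  left_inv P := by
    obtain ⟨blocks, h1, h2, h3⟩ := P
    simp only [OrdPartition.mk.injEq]
    ext i x
    simp only [mem_filter, mem_univ, true_and]
    constructor
    · rintro rfl
      exact (h3 x).choose_spec
    · intro hx
      by_contra h
      exact Finset.disjoint_left.1 (h2 _ _ h) (h3 x).choose_spec hx
  right_inv f := by
    ext x
    have h : ∃ i, x ∈ ({x | f.1 x = i} : Finset (Fin n)) := ⟨f.1 x, by simp⟩
    exact congrArg Fin.val (mem_filter.1 h.choose_spec).2.symm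

theorem OrdPartition.mem_blocks_iff (P : OrdPartition n k) (x : Fin n) (i : Fin k) :
    x ∈ P.blocks i ↔ (OrdPartition.equivSurjective n k P).1 x = i := by
  conv_lhs => rw [← (OrdPartition.equivSurjective n k).symm_apply_apply P]
  simp [OrdPartition.equivSurjective]

theorem opContains_iff (P : OrdPartition n k) (p : Equiv.Perm (Fin m)) :
    OPContains P p ↔ WordContains (OrdPartition.equivSurjective n k P).1 p⁻¹ := by
  simp only [OPContains, WordContains, P.mem_blocks_iff]
  set f := (OrdPartition.equivSurjective n k P).1
  constructor
  · rintro ⟨ι, hι, b, hb, h⟩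
    refine ⟨b ∘ ⇑p⁻¹, fun a c hac => (h _ _).2 (by simpa using hac), fun a c => ?_⟩
    simp [hb, hι.lt_iff_lt]
  · rintro ⟨ι, hι, h⟩
    refine ⟨f ∘ ι ∘ p, fun a c hac => (h _ _).2 (by simpa using hac), ι ∘ p, fun _ => rfl,
      fun a c => hι.lt_iff_lt⟩

theorem opAvoidCount_eq_card_surjective (p : Equiv.Perm (Fin m)) :
    opAvoidCount n k m p =
      Nat.card {f : Fin n → Fin k // Function.Surjective f ∧ ¬ WordContains f p⁻¹} :=
  Nat.card_congr <|
    ((OrdPartition.equivSurjective n k).subtypeEquiv fun P => by rw [opContains_iff]).trans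
      (Equiv.subtypeSubtypeEquivSubtypeInter (fun f : Fin n → Fin k => Function.Surjective f)
        fun f => ¬ WordContains f p⁻¹)

/-- The words with letter set `S` correspond to the surjective words over `[#S]`. -/
theorem card_avoiding_with_image (S : Finset (Fin k)) (p : Equiv.Perm (Fin m)) :
    Nat.card {w : Fin n → Fin k // univ.image w = S ∧ ¬ WordContains w p} =
      Nat.card {f : Fin n → Fin #S // Function.Surjective f ∧ ¬ WordContains f p} := by
  symm
  set e := S.orderEmbOfFin rfl
  have he : StrictMono e := e.strictMono
  refine Nat.card_eq_of_bijective
    (fun f => ⟨e ∘ f.1, ?_, by rw [wordContains_comp_iff he]; exact f.2.2⟩) ⟨?_, ?_⟩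
  · rw [← image_image, image_univ_of_surjective f.2.1]
    simp [e]
  · intro f g h
    have := congrArg Subtype.val h
    exact Subtype.ext (e.injective.comp_left this)
  · rintro ⟨w, hw, hp⟩
    have hex : ∀ x, ∃ i, e i = w x := fun x => by
      have : w x ∈ Set.range e := by
        rw [range_orderEmbOfFin, ← hw]; simp
      exact this
    choose f hf using hex
    have hfw : e ∘ f = w := funext hf
    refine ⟨⟨f, fun i => ?_, ?_⟩, Subtype.ext hfw⟩
    · have : e i ∈ univ.image w := by rw [hw]; exact orderEmbOfFin_mem _ _ _
      obtain ⟨x, -, hx⟩ := mem_image.1 this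
      exact ⟨x, e.injective (by rw [hf, hx])⟩
    · rw [← wordContains_comp_iff he, hfw]; exact hp

theorem wordAvoidCount_eq_sum (p : Equiv.Perm (Fin m)) :
    wordAvoidCount n k m p⁻¹ = ∑ j ∈ range (k + 1), k.choose j * opAvoidCount n j m p := by
  classical
  have h : ∀ S : Finset (Fin k),
      #{w : Fin n → Fin k | ¬ WordContains w p⁻¹ ∧ univ.image w = S} = opAvoidCount n #S m p := by
    intro S
    rw [opAvoidCount_eq_card_surjective, ← card_avoiding_with_image, Nat.card_eq_fintype_card,
      Fintype.card_subtype]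
    simp only [and_comm]
  rw [wordAvoidCount, Nat.card_eq_fintype_card, Fintype.card_subtype,
    card_eq_sum_card_fiberwise (f := fun w => univ.image w) (t := univ) (by simp)]
  simp only [filter_filter, h]
  rw [← powerset_univ, sum_powerset_apply_card (fun j => opAvoidCount n j m p)]
  simp

theorem p321_inv : p321⁻¹ = p321 := by decide

end Pattern

section Count

variable {n k : ℕ}

/-- `w` extends a `321`-avoiding word with maximum `M` whose last non-maximal letter is `m` to a
`321`-avoiding word. -/
def IsCompletion (m M : ℕ) (w : Fin n → Fin k) : Prop :=
  (∀ i, m ≤ w i) ∧ (∀ i j, i < j → (w i : ℕ) < M → w i ≤ w j) ∧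
    ∀ i j l, i < j → j < l → w j < w i → w j ≤ w l

theorem isCompletion_zero_zero_iff (w : Fin n → Fin k) :
    IsCompletion 0 0 w ↔ ¬ WordContains w p321 := by
  simp only [IsCompletion, wordContains_p321_iff]
  push Not
  simp

theorem isCompletion_cons_iff {m M : ℕ} (hmM : m ≤ M) (c : Fin k) (w : Fin n → Fin k) :
    IsCompletion m M (Fin.cons c w : Fin (n + 1) → Fin k) ↔
      (M ≤ c ∧ IsCompletion m c w) ∨ (m ≤ c ∧ c < M ∧ IsCompletion c M w) := by
  simp only [IsCompletion, Fin.forall_fin_succ, Fin.cons_zero, Fin.cons_succ, Fin.succ_lt_succ_iff,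
    Fin.succ_pos, Fin.not_lt_zero, false_imp_iff, forall_const, true_and, implies_true]
  constructor
  · rintro ⟨⟨h1, h2⟩, ⟨h3, h4⟩, h5, h6⟩
    rcases le_or_gt M c with h | h
    · exact Or.inl ⟨h, h2, h5, h6⟩
    · exact Or.inr ⟨h1, h, fun i => h3 i h, h4, h6⟩
  · rintro (⟨h, h2, h5, h6⟩ | ⟨h1, h, h3, h4, h6⟩)
    · exact ⟨⟨hmM.trans h, h2⟩, ⟨fun _ h' => absurd h h'.not_ge,
        fun i j hij hi => h5 i j hij (hi.trans_le h)⟩, h5, h6⟩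
    · exact ⟨⟨h1, fun i => h1.trans (h3 i)⟩, ⟨fun i _ => h3 i, h4⟩,
        fun i _ _ hi => absurd (h3 i) hi.not_ge, h6⟩

open Classical in
/-- The number of completions of length `n`, over the alphabet `[k]`. -/
noncomputable def completionCount (n k m M : ℕ) : ℤ :=
  ∑ w : Fin n → Fin k, if IsCompletion m M w then 1 else 0

theorem completionCount_zero_left (k m M : ℕ) : completionCount 0 k m M = 1 := by
  simp [completionCount, IsCompletion]

theorem completionCount_succ {m M : ℕ} (n k : ℕ) (hmM : m ≤ M) :
    completionCount (n + 1) k m M = ∑ c ∈ range k,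
      if M ≤ c then completionCount n k m c else if m ≤ c then completionCount n k c M else 0 := by
  classical
  rw [← Fin.sum_univ_eq_sum_range (fun c => if M ≤ c then completionCount n k m c
    else if m ≤ c then completionCount n k c M else 0)]
  simp only [completionCount]
  rw [← (Fin.consEquiv fun _ => Fin k).sum_comp, Fintype.sum_prod_type]
  refine sum_congr rfl fun c _ => ?_
  simp only [Fin.consEquiv, Equiv.coe_fn_mk, isCompletion_cons_iff hmM]
  split_ifs with h1 h2
  · simp [h1, h1.not_gt]
  · simp [h1, h2, not_le.1 h1]
  · simp [h1, h2]

open PowerSeries in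
theorem completionCount_eq_coeff (n a d m : ℕ) :
    completionCount n (m + d + (a + 1)) m (m + d) = coeff a (coeff n (completionSeries d)) := by
  induction n generalizing a d m with
  | zero => rw [completionCount_zero_left, coeff_coeff_zero_completionSeries]
  | succ n ih =>
    rw [completionCount_succ _ _ (Nat.le_add_right m d), coeff_coeff_succ_completionSeries,
      sum_range_add, sum_range_add, sum_eq_zero, zero_add, add_comm]
    · congr 1
      · refine sum_congr rfl fun i hi => ?_
        rw [if_pos (Nat.le_add_right _ _), ← ih]
        have := mem_range.1 hi
        congr 1 <;> omega
      · rw [← sum_range_reflect]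
        refine sum_congr rfl fun i hi => ?_
        have := mem_range.1 hi
        rw [if_neg (by omega), if_pos (by omega), ← ih _ _ (m + (d - 1 - i))]
        congr 1 <;> omega
    · intro c hc
      have := mem_range.1 hc
      rw [if_neg (by omega), if_neg (by omega)]

theorem wordAvoidCount_p321_succ (n k : ℕ) :
    (wordAvoidCount n (k + 1) 3 p321 : ℤ) =
      PowerSeries.coeff k (PowerSeries.coeff n PowerSeries.wordSeries) := by
  classical
  have h := completionCount_eq_coeff n k 0 0
  rw [PowerSeries.completionSeries, pow_zero, mul_one] at h
  simp only [zero_add] at h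
  rw [← h, wordAvoidCount, Nat.card_eq_fintype_card, Fintype.card_subtype]
  simp only [completionCount, isCompletion_zero_zero_iff, sum_boole]

end Count

section Recurrence

/-- The numbers of `321`-avoiding words, extended by zero to negative lengths. -/
noncomputable def wordExt (n : ℤ) (k : ℕ) : ℤ :=
  if 0 ≤ n then (wordAvoidCount n.toNat k 3 p321 : ℤ) else 0

theorem wordExt_eq_sum (n : ℤ) (k : ℕ) :
    wordExt n k = ∑ j ∈ range (k + 1), (k.choose j : ℤ) * opExt n j := by
  rcases lt_or_ge n 0 with h | h
  · simp [wordExt, opExt, h.not_ge]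
  · have := wordAvoidCount_eq_sum (n := n.toNat) (k := k) p321
    rw [p321_inv] at this
    simp [wordExt, opExt, h, this]

theorem wordExt_zero_right (n : ℤ) : wordExt n 0 = if n = 0 then 1 else 0 := by
  rcases lt_trichotomy n 0 with h | rfl | h
  · rw [wordExt, if_neg h.not_ge, if_neg h.ne]
  · simp [wordExt, wordAvoidCount, wordContains_p321_iff]
  · lift n to ℕ using h.le
    have : NeZero n := ⟨by omega⟩
    simp [wordExt, wordAvoidCount, NeZero.ne n]

theorem wordExt_natCast_succ (n k : ℕ) : wordExt n (k + 1) =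
    PowerSeries.coeff k (PowerSeries.coeff n PowerSeries.wordSeries) := by
  simp [wordExt, wordAvoidCount_p321_succ]

open PowerSeries in
theorem wordExt_recurrence (n : ℤ) (k : ℕ) :
    (n + 4) * (wordExt (n + 3) (k + 1) - wordExt (n + 3) k) =
      (5 * n + 14) * wordExt (n + 2) (k + 1) - (n + 4) * wordExt (n + 2) k
        - (8 * n + 14) * wordExt (n + 1) (k + 1) + (4 * n + 4) * wordExt n (k + 1) := by
  have hode : X * d⁄dX _ wordSeries + wordSeries - C X * (X * d⁄dX _ wordSeries + wordSeries) =
      X * ((5 : ℤ) • (X * d⁄dX _ wordSeries) + (4 : ℤ) • wordSeries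
        - C X * (X * d⁄dX _ wordSeries + (2 : ℤ) • wordSeries))
        - X * (X * ((8 : ℤ) • (X * d⁄dX _ wordSeries) + (6 : ℤ) • wordSeries))
        + X * (X * (X * ((4 : ℤ) • (X * d⁄dX _ wordSeries) + (4 : ℤ) • wordSeries)))
        + 1 - (2 : ℤ) • X := by
    simp only [zsmul_eq_mul]
    push_cast
    linear_combination derivative_wordSeries
  have hθ (N i : ℕ) : coeff i (coeff N (X * d⁄dX _ wordSeries)) = N * wordExt N (i + 1) := by
    rw [wordExt_natCast_succ]
    cases N with
    | zero => simp
    | succ N =>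
      have : ((N : ℤ⟦X⟧) + 1) = C ((N : ℤ) + 1) := by simp
      rw [coeff_succ_X_mul, coeff_derivative, this, coeff_mul_C]
      push_cast
      ring
  generalize X * d⁄dX _ wordSeries = E at hode hθ
  rcases lt_or_ge n (-3) with hn | hn
  · simp [wordExt, show ¬ 0 ≤ n + 3 by omega, show ¬ 0 ≤ n + 2 by omega,
      show ¬ 0 ≤ n + 1 by omega, show ¬ 0 ≤ n by omega]
  obtain ⟨N, hN⟩ := Int.eq_ofNat_of_zero_le (show 0 ≤ n + 3 by omega)
  obtain rfl : n = N - 3 := by omega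
  have hrec := congrArg (fun f => coeff k (coeff N f)) hode
  have hneg (i j : ℕ) (h : 0 < i) : wordExt (-i) j = 0 := by
    rw [wordExt, if_neg (by omega)]
  have hneg1 := hneg 1
  have hneg2 := hneg 2
  have hneg3 := hneg 3
  have hpos2 (m : ℕ) : 2 + (m : ℤ) ≠ 0 := by omega
  have hpos3 (m : ℕ) : 3 + (m : ℤ) ≠ 0 := by omega
  rcases N with _ | _ | _ | N <;> rcases k with _ | k
  all_goals
    simp only [map_add, map_sub, map_zsmul, coeff_zero_coeff_C_X_mul, coeff_succ_coeff_C_X_mul,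
      coeff_succ_X_mul, coeff_zero_X_mul, coeff_one, coeff_X, hθ, ← wordExt_natCast_succ,
      smul_eq_mul] at hrec
    simp [wordExt_zero_right] at hrec hneg1 hneg2 hneg3 ⊢
    ring_nf at hrec hneg1 hneg2 hneg3 ⊢
    try simp only [hneg1, hneg2, hneg3, hpos2, hpos3, if_false]
    linarith

theorem sum_choose_succ_mul_eq (f : ℕ → ℤ) (k : ℕ) :
    ∑ j ∈ range (k + 2), ((k + 1).choose j : ℤ) * f j =
      ∑ j ∈ range (k + 1), (k.choose j : ℤ) * (f j + f (j + 1)) := by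
  simp only [mul_add, sum_add_distrib]
  exact sum_choose_succ_mul (fun i _ => f i) k

theorem eq_zero_of_sum_choose_mul_eq_zero {f : ℕ → ℤ}
    (h : ∀ k, ∑ j ∈ range (k + 1), (k.choose j : ℤ) * f j = 0) (k : ℕ) : f k = 0 := by
  induction k using Nat.strong_induction_on with
  | _ k ih =>
    have := h k
    rw [sum_range_succ, sum_eq_zero fun j hj => by rw [ih j (mem_range.1 hj), mul_zero]] at this
    simpa using this

end Recurrence

theorem op_321_double_recurrence_one (n : ℤ) (k : ℕ) :
    (n + 4) * opExt (n + 3) (k + 1) =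
      (5 * n + 14) * opExt (n + 2) (k + 1) + (4 * n + 10) * opExt (n + 2) k
        - (8 * n + 14) * (opExt (n + 1) (k + 1) + opExt (n + 1) k)
        + (4 * n + 4) * (opExt n (k + 1) + opExt n k) := by
  have hsucc (n : ℤ) (k : ℕ) : wordExt n (k + 1) =
      ∑ j ∈ range (k + 1), (k.choose j : ℤ) * (opExt n j + opExt n (j + 1)) := by
    rw [wordExt_eq_sum, sum_choose_succ_mul_eq]
    push_cast
    rfl
  rw [← sub_eq_zero]
  refine eq_zero_of_sum_choose_mul_eq_zero (f := fun k : ℕ =>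
    (n + 4) * opExt (n + 3) (k + 1) -
      ((5 * n + 14) * opExt (n + 2) (k + 1) + (4 * n + 10) * opExt (n + 2) k
        - (8 * n + 14) * (opExt (n + 1) (k + 1) + opExt (n + 1) k)
        + (4 * n + 4) * (opExt n (k + 1) + opExt n k))) (fun k => ?_) k
  have h := wordExt_recurrence n k
  simp only [hsucc] at h
  simp only [wordExt_eq_sum] at h
  rw [← sub_eq_zero] at h
  rw [← h]
  simp only [mul_sub, mul_sum, ← sum_sub_distrib, ← sum_add_distrib]
  exact sum_congr rfl fun j _ => by ring
end

section
/- For each r ≥ 0 there exists a polynomial Q_r(n) of degree at most 2r with rational coefficients such that for all n ≥ 0, op_{n+r,n}(321) = ((2n)!/(n!·(n+r+1)!))·Q_r(n). Moreover Q_0(n) = 1, Q_1(n) = 3n^2, and Q_2(n) = (9n^4 + 16n^3 + 5n^2 - 6n)/2. -/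
open Finset BigOperators

/-- Every letter of `w` that is smaller than some earlier letter is less than `b`. -/
def DescentsBelow {n k : ℕ} (w : Fin n → Fin k) (b : ℕ) : Prop :=
  ∀ i j, i < j → w j < w i → (w j : ℕ) < b

/-- The word `w` has no strictly decreasing subsequence of length three. -/
def NoDecTriple {n k : ℕ} (w : Fin n → Fin k) : Prop :=
  ∀ i j l, i < j → j < l → w j < w i → w j ≤ w l

open Classical in
/-- The number of surjective words of length `n` over `[k]` without decreasing triples whose
letters preceded by a larger one are all less than `b`. -/
noncomputable def surjCount (n k b : ℕ) : ℕ :=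
  #{w : Fin n → Fin k | Function.Surjective w ∧ NoDecTriple w ∧ DescentsBelow w b}

theorem descentsBelow_snoc {n k : ℕ} (w : Fin n → Fin k) (v : Fin k) (b : ℕ) :
    DescentsBelow (Fin.snoc w v : Fin (n + 1) → Fin k) b ↔
      DescentsBelow w b ∧ ∀ i, v < w i → (v : ℕ) < b := by
  simp [DescentsBelow, Fin.forall_fin_succ', forall_and, Fin.not_lt.2 (Fin.le_last _)]

theorem noDecTriple_snoc {n k : ℕ} (w : Fin n → Fin k) (v : Fin k) :
    NoDecTriple (Fin.snoc w v : Fin (n + 1) → Fin k) ↔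
      NoDecTriple w ∧ DescentsBelow w (v + 1) := by
  simp [NoDecTriple, DescentsBelow, Fin.forall_fin_succ', forall_and,
    Fin.not_lt.2 (Fin.le_last _)]

theorem surjective_snoc {n k : ℕ} (w : Fin n → Fin (k + 1)) (v : Fin (k + 1)) :
    Function.Surjective (Fin.snoc w v : Fin (n + 1) → Fin (k + 1)) ↔
      Function.Surjective w ∨
        ∃ u : Fin n → Fin k, Function.Surjective u ∧ v.succAbove ∘ u = w := by
  have key : Function.Surjective (Fin.snoc w v : Fin (n + 1) → Fin (k + 1)) ↔
      ∀ a, a ≠ v → ∃ i, w i = a := by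
    refine forall_congr' fun a => ?_
    rw [Fin.exists_fin_succ']
    simp only [Fin.snoc_castSucc, Fin.snoc_last]
    tauto
  rw [key]
  constructor
  · intro h
    by_cases hv : ∃ i, w i = v
    · exact Or.inl fun a => if ha : a = v then ha ▸ hv else h a ha
    · right
      have hw : ∀ i, ∃ c, v.succAbove c = w i := fun i =>
        Fin.exists_succAbove_eq fun e => hv ⟨i, e⟩
      choose u hu using hw
      refine ⟨u, fun c => ?_, funext hu⟩
      obtain ⟨i, hi⟩ := h (v.succAbove c) (Fin.succAbove_ne v c)
      exact ⟨i, Fin.succAbove_right_injective ((hu i).trans hi)⟩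
  · rintro (h | ⟨u, hu, rfl⟩) a ha
    · exact h a
    · obtain ⟨c, rfl⟩ := Fin.exists_succAbove_eq ha
      obtain ⟨i, rfl⟩ := hu c
      exact ⟨i, rfl⟩

theorem noDecTriple_succAbove_comp {n k : ℕ} (u : Fin n → Fin k) (v : Fin (k + 1)) :
    NoDecTriple (v.succAbove ∘ u) ↔ NoDecTriple u := by
  simp [NoDecTriple, Fin.succAbove_lt_succAbove_iff, Fin.succAbove_le_succAbove_iff]

theorem descentsBelow_succAbove_comp {n k : ℕ} (u : Fin n → Fin k) (v : Fin (k + 1)) {b : ℕ}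
    (hb : b ≤ v) : DescentsBelow (v.succAbove ∘ u) b ↔ DescentsBelow u b := by
  simp only [DescentsBelow, Function.comp_apply, Fin.succAbove_lt_succAbove_iff]
  have : ∀ c : Fin k, (v.succAbove c : ℕ) < b ↔ (c : ℕ) < b := by
    intro c
    rcases lt_or_ge c.castSucc v with h | h
    · simp [Fin.succAbove_of_castSucc_lt _ _ h]
    · rw [Fin.succAbove_of_le_castSucc _ _ h]
      have : (v : ℕ) ≤ c := h
      simp only [Fin.val_succ]
      omega
  simp [this]

theorem descentsBelow_succAbove_comp_succ {n k : ℕ} (u : Fin n → Fin k) (v : Fin (k + 1)) :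
    DescentsBelow (v.succAbove ∘ u) (v + 1) ↔ DescentsBelow u v := by
  rw [← descentsBelow_succAbove_comp u v le_rfl]
  simp only [DescentsBelow, Function.comp_apply]
  refine forall₄_congr fun i j _ _ => ?_
  have := Fin.val_ne_of_ne (Fin.succAbove_ne v (u j))
  omega

theorem DescentsBelow.mono {n k : ℕ} {w : Fin n → Fin k} {b c : ℕ} (h : DescentsBelow w b)
    (hbc : b ≤ c) : DescentsBelow w c :=
  fun i j hij hw => (h i j hij hw).trans_le hbc

/-- In a word over `[k + 1]`, only letters less than `k` are preceded by larger ones. -/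
theorem descentsBelow_of_le {n k b : ℕ} (w : Fin n → Fin (k + 1)) (hb : k ≤ b) :
    DescentsBelow w b := by
  intro i j _ h
  have h1 : (w j : ℕ) < w i := h
  have := (w i).is_lt
  omega

theorem surjCount_of_le (n k : ℕ) {b : ℕ} (hb : k ≤ b) :
    surjCount n (k + 1) b = surjCount n (k + 1) k := by
  rw [surjCount, surjCount]
  congr 1
  ext w
  simp [descentsBelow_of_le w hb, descentsBelow_of_le w le_rfl]

theorem surjCount_zero_zero (b : ℕ) : surjCount 0 0 b = 1 := by
  simp [surjCount, NoDecTriple, DescentsBelow, Function.Surjective]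

theorem surjCount_succ_zero (n b : ℕ) : surjCount (n + 1) 0 b = 0 := by
  simp [surjCount]

theorem surjCount_zero_succ (k b : ℕ) : surjCount 0 (k + 1) b = 0 := by
  simp [surjCount, Function.Surjective]

theorem card_filter_snoc {n k : ℕ} (P : (Fin (n + 1) → Fin k) → Prop) [DecidablePred P]
    [∀ v, DecidablePred fun w : Fin n → Fin k => P (Fin.snoc w v)] :
    #{w | P w} = ∑ v, #{w : Fin n → Fin k | P (Fin.snoc w v)} := by
  simp only [Finset.card_filter]
  rw [← Fintype.sum_prod_type' fun v w => if P (Fin.snoc w v) then 1 else 0]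
  rw [← (Fin.snocEquiv fun _ => Fin k).sum_comp]
  exact Finset.sum_congr rfl fun _ _ => if_congr Iff.rfl rfl rfl

open Classical in
/-- Words with a prescribed last letter `v`, according to whether `v` occurs earlier. -/
theorem card_snoc_eq {n k : ℕ} (v : Fin (k + 1)) (b : ℕ) :
    #{w : Fin n → Fin (k + 1) | Function.Surjective (Fin.snoc w v : Fin (n + 1) → Fin (k + 1)) ∧
        NoDecTriple (Fin.snoc w v : Fin (n + 1) → Fin (k + 1)) ∧
        DescentsBelow (Fin.snoc w v : Fin (n + 1) → Fin (k + 1)) b} =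
      #{w : Fin n → Fin (k + 1) | Function.Surjective w ∧ NoDecTriple w ∧
        DescentsBelow w (v + 1) ∧ DescentsBelow w b ∧ ∀ i, v < w i → (v : ℕ) < b} +
      #{u : Fin n → Fin k | Function.Surjective u ∧ NoDecTriple u ∧
        DescentsBelow u v ∧ DescentsBelow (v.succAbove ∘ u) b ∧
          ∀ i, v < v.succAbove (u i) → (v : ℕ) < b} := by
  have hinj : Function.Injective fun u : Fin n → Fin k => v.succAbove ∘ u :=
    (Fin.succAbove_right_injective (p := v)).comp_left
  rw [← Finset.card_image_of_injective _ hinj, ← Finset.card_union_of_disjoint]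
  · congr 1
    ext w
    simp only [Finset.mem_filter_univ, Finset.mem_union, Finset.mem_image, surjective_snoc,
      noDecTriple_snoc, descentsBelow_snoc]
    constructor
    · rintro ⟨h | ⟨u, hu, rfl⟩, ⟨h1, h2⟩, h3, h4⟩
      · exact Or.inl ⟨h, h1, h2, h3, h4⟩
      · exact Or.inr ⟨u, ⟨hu, (noDecTriple_succAbove_comp u v).1 h1,
          (descentsBelow_succAbove_comp_succ u v).1 h2, h3, h4⟩, rfl⟩
    · rintro (⟨h, h1, h2, h3, h4⟩ | ⟨u, ⟨hu, h1, h2, h3, h4⟩, rfl⟩)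
      · exact ⟨Or.inl h, ⟨h1, h2⟩, h3, h4⟩
      · exact ⟨Or.inr ⟨u, hu, rfl⟩, ⟨(noDecTriple_succAbove_comp u v).2 h1,
          (descentsBelow_succAbove_comp_succ u v).2 h2⟩, h3, h4⟩
  · rw [Finset.disjoint_left]
    simp only [Finset.mem_filter_univ, Finset.mem_image]
    rintro _ ⟨hw, -⟩ ⟨u, -, rfl⟩
    obtain ⟨i, hi⟩ := hw v
    exact Fin.succAbove_ne v (u i) hi

theorem surjCount_succ_succ (n k b : ℕ) :
    surjCount (n + 1) (k + 1) b = (∑ v : Fin k, if (v : ℕ) < b then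
      surjCount n (k + 1) (v + 1) + surjCount n k v else 0) +
        (surjCount n (k + 1) b + surjCount n k b) := by
  classical
  rw [surjCount, card_filter_snoc, Fin.sum_univ_castSucc]
  congr 1
  · refine Finset.sum_congr rfl fun v _ => ?_
    rw [card_snoc_eq]
    split_ifs with hv
    · congr 1
      · rw [surjCount]
        congr 1
        ext w
        simp only [Finset.mem_filter_univ, Fin.val_castSucc]
        exact ⟨fun h => ⟨h.1, h.2.1, h.2.2.1⟩,
          fun h => ⟨h.1, h.2.1, h.2.2, h.2.2.mono hv, fun _ _ => hv⟩⟩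
      · rw [surjCount]
        congr 1
        ext u
        simp only [Finset.mem_filter_univ, Fin.val_castSucc]
        exact ⟨fun h => ⟨h.1, h.2.1, h.2.2.1⟩,
          fun h => ⟨h.1, h.2.1, h.2.2,
            ((descentsBelow_succAbove_comp_succ u v.castSucc).2 h.2.2).mono hv, fun _ _ => hv⟩⟩
    · rw [Nat.add_eq_zero_iff]
      simp only [Finset.card_eq_zero, Finset.filter_eq_empty_iff, Finset.mem_univ, forall_const]
      constructor
      · rintro w ⟨hw, -, -, -, h⟩
        obtain ⟨i, hi⟩ := hw (Fin.last k)
        exact hv (h i (hi ▸ Fin.castSucc_lt_last v))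
      · rintro u ⟨hu, -, -, -, h⟩
        obtain ⟨i, hi⟩ := hu v
        refine hv (h i ?_)
        rw [hi, Fin.succAbove_castSucc_self]
        exact Fin.castSucc_lt_succ
  · rw [card_snoc_eq]
    congr 1
    · rw [surjCount]
      congr 1
      ext w
      simp [descentsBelow_of_le, Fin.not_lt.2 (Fin.le_last _)]
    · rw [surjCount]
      congr 1
      ext u
      have h1 : DescentsBelow u k := fun i j _ _ => (u j).is_lt
      have h2 : DescentsBelow (Fin.castSucc ∘ u) b ↔ DescentsBelow u b := by
        simp [DescentsBelow]
      have h3 : ∀ i, ¬ Fin.last k < (u i).castSucc := fun i => (Fin.le_last _).not_gt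
      simp [h1, h2, h3, Fin.succAbove_last]

theorem surjCount_succ_succ_zero (n k : ℕ) :
    surjCount (n + 1) (k + 1) 0 = surjCount n (k + 1) 0 + surjCount n k 0 := by
  simp [surjCount_succ_succ n k 0]

theorem surjCount_succ_succ_succ (n k j : ℕ) (hj : j < k) :
    surjCount (n + 1) (k + 1) (j + 1) + surjCount n (k + 1) j =
      surjCount (n + 1) (k + 1) j + 2 * surjCount n (k + 1) (j + 1) + surjCount n k (j + 1) := by
  have hsum : (∑ v : Fin k, if (v : ℕ) < j + 1 then
      surjCount n (k + 1) (v + 1) + surjCount n k v else 0) =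
      (∑ v : Fin k, if (v : ℕ) < j then surjCount n (k + 1) (v + 1) + surjCount n k v else 0) +
        (surjCount n (k + 1) (j + 1) + surjCount n k j) := by
    rw [← Fintype.sum_ite_eq' (⟨j, hj⟩ : Fin k)
      fun v => surjCount n (k + 1) (v + 1) + surjCount n k v, ← Finset.sum_add_distrib]
    refine Finset.sum_congr rfl fun v _ => ?_
    rcases lt_trichotomy (v : ℕ) j with h | h | h
    · simp [h, h.trans (Nat.lt_succ_self j), Fin.ext_iff, h.ne]
    · simp [h, Fin.ext_iff]
    · simp [h.not_gt, Fin.ext_iff, h.ne', h.not_ge]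
  rw [surjCount_succ_succ n k (j + 1), surjCount_succ_succ n k j, hsum]
  ring

namespace OrdPartition

variable {n k : ℕ}

/-- The index of the block containing `x`. -/
noncomputable def blockIndex (P : OrdPartition n k) (x : Fin n) : Fin k :=
  (P.blocks_cover x).choose

theorem mem_blocks_iff_s16 (P : OrdPartition n k) (x : Fin n) (i : Fin k) :
    x ∈ P.blocks i ↔ P.blockIndex x = i := by
  have hx : x ∈ P.blocks (P.blockIndex x) := (P.blocks_cover x).choose_spec
  constructor
  · intro h
    by_contra hne
    exact Finset.disjoint_left.1 (P.blocks_disjoint _ _ hne) hx h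
  · rintro rfl
    exact hx

theorem blockIndex_surjective (P : OrdPartition n k) : Function.Surjective P.blockIndex :=
  fun i => (P.blocks_nonempty i).imp fun x hx => (P.mem_blocks_iff_s16 x i).1 hx

theorem blockIndex_bijective :
    Function.Bijective fun P : OrdPartition n k =>
      (⟨P.blockIndex, P.blockIndex_surjective⟩ : {w : Fin n → Fin k // Function.Surjective w}) := by
  constructor
  · intro P P' h
    have hw : P.blockIndex = P'.blockIndex := Subtype.ext_iff.1 h
    have hb : P.blocks = P'.blocks := by
      funext i
      ext x
      rw [P.mem_blocks_iff_s16, P'.mem_blocks_iff_s16, hw]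
    cases P
    cases P'
    cases hb
    rfl
  · rintro ⟨w, hw⟩
    let P : OrdPartition n k :=
      { blocks := fun i => {x | w x = i}
        blocks_nonempty := fun i => (hw i).imp fun x hx => by simpa using hx
        blocks_disjoint := fun i j hij => Finset.disjoint_left.2 fun x hx hx' => by
          simp only [Finset.mem_filter_univ] at hx hx'
          exact hij (hx.symm.trans hx')
        blocks_cover := fun x => ⟨w x, by simp⟩ }
    exact ⟨P, Subtype.ext (funext fun x => (P.mem_blocks_iff_s16 x (w x)).1 (by simp [P]))⟩

/-- An ordered set partition amounts to the surjection sending each element to the index of its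
block. -/
noncomputable def equivSurj (n k : ℕ) :
    OrdPartition n k ≃ {w : Fin n → Fin k // Function.Surjective w} :=
  Equiv.ofBijective _ blockIndex_bijective

end OrdPartition

theorem not_opContains_p321_iff {n k : ℕ} (P : OrdPartition n k) :
    ¬ OPContains P p321 ↔ NoDecTriple P.blockIndex := by
  simp only [OPContains, P.mem_blocks_iff_s16, NoDecTriple]
  generalize P.blockIndex = w
  constructor
  · intro h i j l hij hjl hji
    by_contra! hlj
    refine h ⟨![w l, w j, w i], ?_, ![l, j, i], ?_, ?_⟩
    · intro a b hab
      have := hlj.trans hji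
      fin_cases a <;> fin_cases b <;> simp_all
    · intro a
      fin_cases a <;> rfl
    · intro a b
      have := hij.trans hjl
      fin_cases a <;> fin_cases b <;> simp [p321, hij, hjl, this, hij.le, hjl.le, this.le]
  · rintro h ⟨ι, hι, b, hb, hp⟩
    have h1 : b 2 < b 1 := (hp 2 1).2 (by decide)
    have h2 : b 1 < b 0 := (hp 1 0).2 (by decide)
    have h3 := h _ _ _ h1 h2 (by rw [hb, hb]; exact hι (by decide))
    rw [hb, hb] at h3
    exact h3.not_gt (hι (by decide))

theorem opAvoidCount_p321_s16 (n k b : ℕ) (hb : k ≤ b) :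
    opAvoidCount n k 3 p321 = surjCount n k b := by
  classical
  have hD : ∀ w : Fin n → Fin k, DescentsBelow w b := fun w i j _ _ => (w j).is_lt.trans_le hb
  rw [opAvoidCount, surjCount, ← Fintype.card_subtype, ← Nat.card_eq_fintype_card]
  refine Nat.card_congr (((OrdPartition.equivSurj n k).subtypeEquiv
    (q := fun w => NoDecTriple w.1) not_opContains_p321_iff).trans
      ((Equiv.subtypeSubtypeEquivSubtypeInter _ _).trans (Equiv.subtypeEquivRight fun w => ?_)))
  simp [hD]

open PowerSeries in
theorem coeff_one_add_C_mul_X_pow {R : Type*} [CommRing R] (a : R) (m d : ℕ) :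
    coeff d ((1 + C a * X) ^ m) = a ^ d * (m.choose d : R) := by
  induction m generalizing d with
  | zero => cases d <;> simp [coeff_one]
  | succ m ih =>
    rw [pow_succ', add_mul, one_mul, mul_assoc, map_add, coeff_C_mul]
    cases d with
    | zero => simp [ih]
    | succ d =>
      rw [coeff_succ_X_mul, ih, ih, Nat.choose_succ_succ]
      push_cast
      ring

namespace SurjGF

open PowerSeries

/-- The series in `x` with coefficients series in `z`, both over the rationals. -/
abbrev Series : Type := PowerSeries (PowerSeries ℚ)

/-- The coefficient of `x ^ n * z ^ k`. -/
noncomputable def cf (n k : ℕ) : Series →ₗ[ℚ] ℚ :=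
  (coeff k : PowerSeries ℚ →ₗ[ℚ] ℚ) ∘ₗ
    ((coeff n : Series →ₗ[PowerSeries ℚ] PowerSeries ℚ).restrictScalars ℚ)

theorem cf_apply (n k : ℕ) (f : Series) : cf n k f = coeff k (coeff n f) := rfl

/-- The variable `z`. -/
noncomputable def Z : Series := C X

/-- The series `1 / (1 - x)`. -/
noncomputable def y : Series := PowerSeries.map (C : ℚ →+* PowerSeries ℚ) (mk 1)

/-- The series `1 / (1 + z)`. -/
noncomputable def v : Series := C ((1 + X : PowerSeries ℚ)⁻¹)

theorem y_mul : y * (1 - X) = 1 := by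
  have h := congrArg (PowerSeries.map (C : ℚ →+* PowerSeries ℚ))
    (PowerSeries.mk_one_mul_one_sub_eq_one ℚ)
  simpa [y] using h

theorem v_mul : v * (1 + Z) = 1 := by
  have h : ((1 + X : PowerSeries ℚ)⁻¹) * (1 + X) = 1 :=
    PowerSeries.inv_mul_cancel _ (by simp)
  rw [v, Z, ← map_one (C : PowerSeries ℚ →+* Series), ← map_add, ← map_mul, h]

/-- The argument `x * (1 - x) * (1 + z)` of the Catalan series. -/
noncomputable def w : Series := X * ((1 - X) * (1 + Z))

theorem hasSubst_w : HasSubst w := HasSubst.of_constantCoeff_zero' (by simp [w])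

/-- The Catalan series evaluated at `x * (1 - x) * (1 + z)`. -/
noncomputable def U : Series :=
  substAlgHom (R := ℚ) hasSubst_w (PowerSeries.map (Nat.castRingHom ℚ) catalanSeries)

theorem U_eq : X * (1 - X) * (1 + Z) * U ^ 2 = U - 1 := by
  have h := congrArg (fun f => substAlgHom (R := ℚ) hasSubst_w
    (PowerSeries.map (Nat.castRingHom ℚ) f)) catalanSeries_sq_mul_X_add_one
  simp only [map_add, map_mul, map_pow, map_one, map_X, substAlgHom_X] at h
  rw [← U] at h
  rw [w] at h
  linear_combination h

theorem coeff_U (n : ℕ) : coeff n U =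
    ∑ m ∈ range (n + 1), (catalan m : ℚ) • ((-1) ^ (n - m) * (m.choose (n - m) : PowerSeries ℚ) *
      (1 + X) ^ m) := by
  have hw (m : ℕ) : w ^ m = X ^ m * (C ((1 + X) ^ m) * (1 + C (-1) * X) ^ m) := by
    simp only [w, Z, map_pow, map_add, map_one, map_neg, mul_pow]
    ring
  rw [U, coe_substAlgHom, coeff_subst' hasSubst_w,
    finsum_eq_sum_of_support_subset (s := range (n + 1))]
  · refine Finset.sum_congr rfl fun m hm => ?_
    obtain ⟨d, rfl⟩ := Nat.exists_eq_add_of_le (Nat.lt_succ_iff.1 (Finset.mem_range.1 hm))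
    rw [hw, add_comm m d, coeff_X_pow_mul, coeff_C_mul, coeff_one_add_C_mul_X_pow]
    simp [mul_comm]
  · intro m hm
    by_contra h
    refine hm ?_
    simp only [Finset.coe_range, Set.mem_Iio, not_lt] at h
    have : coeff n (w ^ m) = 0 := by
      rw [hw]
      exact (X_pow_dvd_iff.1 (Dvd.intro _ rfl)) n h
    simp [this]

theorem Z_dvd_U_sub_y : Z ∣ U - y := by
  have hu : IsUnit (1 - X * ((1 - X) * (U + y)) : Series) := by
    rw [isUnit_iff_constantCoeff]
    simp
  rw [← hu.dvd_mul_right]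
  exact ⟨X * (1 - X) * U ^ 2, by linear_combination (-1) * U_eq + (X * y - 1 : Series) * y_mul⟩

/-- The geometric ratio `x * z / (1 - x)`. -/
noncomputable def s : Series := Z * (X * y)

/-- The small root of the characteristic equation. -/
noncomputable def r : Series := X * ((1 + Z) * U - y)

/-- The generating function of `surjCount n k (k - 1 - ℓ)`. -/
noncomputable def gf (ℓ : ℕ) : Series := Z * v * (U - y) * r ^ ℓ + v * s ^ (ℓ + 1)

theorem Z_dvd_r : Z ∣ r := by
  obtain ⟨f, hf⟩ := Z_dvd_U_sub_y
  exact ⟨X * (f + U), by rw [r]; linear_combination X * hf⟩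

theorem s_mul : s * (1 - X) = X * Z := by
  rw [s]
  linear_combination Z * X * y_mul

theorem r_char : r * (1 - r) = X * (2 * r - r ^ 2 + Z) := by
  rw [r]
  linear_combination (-(X * (1 + Z)) : Series) * U_eq +
    (X ^ 2 * (2 * (1 + Z) * U - y) - X : Series) * y_mul

theorem gf_succ_succ (i : ℕ) : gf (i + 1) =
    gf (i + 2) + X * (gf (i + 1) + gf (i + 1) - gf (i + 2) + Z * gf i) - X * s ^ (i + 2) := by
  simp only [gf]
  linear_combination Z * v * (U - y) * r ^ i * r_char + v * s ^ (i + 1) * (1 - s) * s_mul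
    - X * s ^ (i + 2) * v_mul

theorem gf_zero : gf 0 =
    gf 1 + X * (gf 0 + gf 0 - gf 1 + Z * gf 0) + (1 - 2 * X) * s := by
  have hs : s = Z * (X * y) := rfl
  simp only [gf, r]
  linear_combination (1 - 2 * X) * s * v_mul - v * s * s_mul - Z * v * hs - Z * v * U_eq +
    Z * v * (X * (U - y) + X * (1 + Z) * U - 1) * y_mul

theorem cf_X_mul (n k : ℕ) (f : Series) : cf (n + 1) k (X * f) = cf n k f := by
  rw [cf_apply, coeff_succ_X_mul, cf_apply]

theorem cf_Z_mul (n k : ℕ) (f : Series) : cf n (k + 1) (Z * f) = cf n k f := by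
  rw [cf_apply, Z, coeff_C_mul, coeff_succ_X_mul, cf_apply]

theorem cf_Z_pow_mul (n k m : ℕ) (f : Series) : cf n (k + m) (Z ^ m * f) = cf n k f := by
  rw [cf_apply, Z, ← map_pow, coeff_C_mul, coeff_X_pow_mul, cf_apply]

theorem cf_eq_zero_of_dvd {n k m : ℕ} (hk : k < m) {f : Series} (hf : Z ^ m ∣ f) :
    cf n k f = 0 := by
  obtain ⟨g, rfl⟩ := hf
  rw [cf_apply, Z, ← map_pow, coeff_C_mul]
  exact (X_pow_dvd_iff.1 (Dvd.intro _ rfl)) k hk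

theorem cf_map_C (n k : ℕ) (f : PowerSeries ℚ) :
    cf n (k + 1) (PowerSeries.map (C : ℚ →+* PowerSeries ℚ) f) = 0 := by
  simp [cf_apply]

theorem cf_Z_pow_mul_map_C {n k m : ℕ} (hm : m < k) (f : PowerSeries ℚ) :
    cf n k (Z ^ m * PowerSeries.map (C : ℚ →+* PowerSeries ℚ) f) = 0 := by
  obtain ⟨d, rfl⟩ := Nat.exists_eq_add_of_lt hm
  rw [show m + d + 1 = (d + 1) + m by omega, cf_Z_pow_mul, cf_map_C]

theorem cf_X_mul_s_pow {n k m : ℕ} (hm : m < k) : cf n k (X * s ^ m) = 0 := by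
  have h : X * s ^ m = Z ^ m * PowerSeries.map (C : ℚ →+* PowerSeries ℚ)
      (X * (X * PowerSeries.mk 1) ^ m) := by
    simp only [s, y, map_mul, map_pow, map_X]
    ring
  rw [h, cf_Z_pow_mul_map_C hm]

theorem cf_one_sub_mul_s (n k : ℕ) : cf n (k + 2) ((1 - 2 * X) * s) = 0 := by
  have h : (1 - 2 * X) * s = Z ^ 1 * PowerSeries.map (C : ℚ →+* PowerSeries ℚ)
      ((1 - 2 * X) * (X * PowerSeries.mk 1)) := by
    simp only [s, y, map_mul, map_sub, map_one, map_X, map_ofNat]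
    ring
  rw [h, cf_Z_pow_mul_map_C (by omega)]

theorem surjCount_zero_right (n k : ℕ) : (surjCount n k 0 : ℚ) = cf n 0 ((X * y) ^ k) := by
  induction n generalizing k with
  | zero =>
    cases k with
    | zero => simp [surjCount_zero_zero, cf_apply]
    | succ k => simp [surjCount_zero_succ, cf_apply]
  | succ n ih =>
    cases k with
    | zero => simp [surjCount_succ_zero, cf_apply, coeff_one]
    | succ k =>
      have h : (X * y) ^ (k + 1) = X * ((X * y) ^ (k + 1) + (X * y) ^ k : Series) := by
        linear_combination X * (X * y) ^ k * y_mul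
      rw [h, cf_X_mul, map_add, ← ih, ← ih, surjCount_succ_succ_zero]
      push_cast
      rfl

theorem cf_gf_self (n k : ℕ) : cf n (k + 1) (gf k) = cf n 0 ((X * y) ^ (k + 1)) := by
  have h1 : Z ^ (k + 2) ∣ Z * v * (U - y) * r ^ k := by
    have := mul_dvd_mul (mul_dvd_mul (Dvd.intro v rfl : Z ∣ Z * v) Z_dvd_U_sub_y)
      (pow_dvd_pow_of_dvd Z_dvd_r k)
    exact (dvd_of_eq (by ring)).trans this
  have h2 : Z ^ (k + 2) ∣ Z * v * s ^ (k + 1) :=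
    ⟨v * (X * y) ^ (k + 1), by rw [s]; ring⟩
  have h : gf k = Z * v * (U - y) * r ^ k - Z * v * s ^ (k + 1) +
      Z ^ (k + 1) * (X * y) ^ (k + 1) := by
    rw [gf, s]
    linear_combination (Z * (X * y)) ^ (k + 1) * v_mul
  rw [h, map_add, map_sub, cf_eq_zero_of_dvd (by omega) h1, cf_eq_zero_of_dvd (by omega) h2]
  simpa using cf_Z_pow_mul n 0 (k + 1) ((X * y) ^ (k + 1))

theorem cf_zero_gf (k ℓ : ℕ) : cf 0 k (gf ℓ) = 0 := by
  have hs : X ∣ s := ⟨Z * y, by rw [s]; ring⟩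
  have hU : (X : Series) ∣ U - y := by
    rw [X_dvd_iff, map_sub, y, ← coeff_zero_eq_constantCoeff_apply,
      ← coeff_zero_eq_constantCoeff_apply, coeff_U, coeff_map]
    simp
  have : X ∣ gf ℓ := dvd_add ((hU.mul_left _).mul_right _) ((dvd_pow hs (by omega)).mul_left _)
  obtain ⟨f, hf⟩ := this
  simp [cf_apply, hf]

theorem surjCount_eq_cf_gf (n k j : ℕ) (hj : j ≤ k) :
    (surjCount n (k + 1) j : ℚ) = cf n (k + 1) (gf (k - j)) := by
  induction n generalizing k j with
  | zero => simp [surjCount_zero_succ, cf_zero_gf]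
  | succ n ih =>
    induction j with
    | zero => rw [surjCount_zero_right, Nat.sub_zero, cf_gf_self]
    | succ j ihj =>
      obtain ⟨i, rfl⟩ := Nat.exists_eq_add_of_le hj
      have hrec := surjCount_succ_succ_succ n (j + 1 + i) j (by omega)
      have ej : j + 1 + i - j = i + 1 := by omega
      have ej' : j + 1 + i - (j + 1) = i := by omega
      have h1 := ihj (by omega)
      have h2 := ih (j + 1 + i) (j + 1) (by omega)
      have h3 := ih (j + 1 + i) j (by omega)
      rw [ej] at h1 h3
      rw [ej'] at h2 ⊢
      have hrec' : (surjCount (n + 1) (j + 1 + i + 1) (j + 1) : ℚ) =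
          cf (n + 1) (j + 1 + i + 1) (gf (i + 1)) + 2 * cf n (j + 1 + i + 1) (gf i) +
            surjCount n (j + 1 + i) (j + 1) - cf n (j + 1 + i + 1) (gf (i + 1)) := by
        rw [← h1, ← h2, ← h3, eq_sub_iff_add_eq]
        exact_mod_cast hrec
      rw [hrec']
      cases i with
      | zero =>
        have hb : surjCount n (j + 1) (j + 1) = surjCount n (j + 1) j :=
          surjCount_of_le n j (by omega)
        have hg := congrArg (cf (n + 1) (j + 2)) gf_zero
        simp only [map_add, map_sub, cf_one_sub_mul_s, cf_X_mul, cf_Z_mul] at hg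
        rw [add_zero, hb, ih j j le_rfl, Nat.sub_self]
        linear_combination -hg
      | succ i =>
        have h4 := ih (j + 1 + i) (j + 1) (by omega)
        rw [show j + 1 + i - (j + 1) = i by omega] at h4
        have hg := congrArg (cf (n + 1) (j + 1 + i + 2)) (gf_succ_succ i)
        rw [map_sub, map_add, cf_X_mul_s_pow (by omega), cf_X_mul, map_add, map_sub, map_add,
          cf_Z_mul] at hg
        rw [← add_assoc, h4]
        linear_combination -hg

theorem coeff_X_mul_U_sq (n : ℕ) : coeff n (X * (1 - X) * U ^ 2) =
    ∑ m ∈ range n, (catalan (m + 1) : ℚ) •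
      ((-1) ^ (n - (m + 1)) * ((m + 1).choose (n - (m + 1)) : PowerSeries ℚ) * (1 + X) ^ m) := by
  have hne : (1 + X : PowerSeries ℚ) ≠ 0 := fun h => by
    simpa using congrArg (constantCoeff (R := ℚ)) h
  refine mul_left_cancel₀ hne ?_
  have h : coeff n (C (1 + X : PowerSeries ℚ) * (X * (1 - X) * U ^ 2)) = coeff n (U - 1) := by
    rw [← U_eq, Z, map_add, map_one]
    ring_nf
  rw [coeff_C_mul] at h
  rw [h, map_sub, coeff_U, Finset.sum_range_succ', Finset.mul_sum, add_sub_assoc]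
  have h0 : (catalan 0 : ℚ) • ((-1) ^ (n - 0) * ((0 : ℕ).choose (n - 0) : PowerSeries ℚ) *
      (1 + X) ^ 0) - coeff n (1 : Series) = 0 := by
    cases n <;> simp [coeff_one]
  rw [h0, add_zero]
  refine Finset.sum_congr rfl fun m _ => ?_
  rw [mul_smul_comm, pow_succ]
  ring_nf

theorem surjCount_eq_sum (n k : ℕ) : (surjCount n (k + 1) k : ℚ) =
    ∑ m ∈ range n, (catalan (m + 1) : ℚ) * ((-1) ^ (n - (m + 1)) *
      ((m + 1).choose (n - (m + 1)) : ℚ) * (m.choose k : ℚ)) := by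
  have h : gf 0 = Z * (X * (1 - X) * U ^ 2) := by
    rw [gf, s]
    linear_combination (Z * X * (1 - X) * U ^ 2) * v_mul - Z * v * U_eq - Z * v * y_mul
  rw [surjCount_eq_cf_gf n k k le_rfl, Nat.sub_self, h, cf_Z_mul, cf_apply, coeff_X_mul_U_sq,
    map_sum]
  refine Finset.sum_congr rfl fun m _ => ?_
  have h1 (d c : ℕ) : ((-1) ^ d * (c : PowerSeries ℚ) * (1 + X) ^ m) =
      C ((-1) ^ d * (c : ℚ)) * (1 + C 1 * X) ^ m := by
    simp
  rw [map_smul, h1, coeff_C_mul, coeff_one_add_C_mul_X_pow, smul_eq_mul, one_pow, one_mul]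

end SurjGF

theorem surjCount_diagonal (k r : ℕ) : (surjCount (k + 1 + r) (k + 1) k : ℚ) =
    ∑ s ∈ range (r + 1), (catalan (k + 1 + s) : ℚ) * ((-1) ^ (r - s) *
      ((k + 1 + s).choose (r - s) : ℚ) * ((k + s).choose s : ℚ)) := by
  rw [SurjGF.surjCount_eq_sum, show k + 1 + r = k + (r + 1) by omega, Finset.sum_range_add,
    Finset.sum_eq_zero, zero_add]
  · refine Finset.sum_congr rfl fun s _ => ?_
    rw [show k + (r + 1) - (k + s + 1) = r - s by omega, Nat.choose_symm_add (a := k),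
      show k + s + 1 = k + 1 + s by omega]
  · intro m hm
    simp [Nat.choose_eq_zero_of_lt (Finset.mem_range.1 hm)]

theorem factorial_two_mul_add (n s : ℕ) :
    ((2 * (n + s)).factorial : ℚ) * n.factorial =
      (2 * n).factorial * (n + s).factorial * ∏ i ∈ range s, 2 * (2 * (n : ℚ) + (2 * i + 1)) := by
  induction s with
  | zero => simp
  | succ s ih =>
    rw [Finset.prod_range_succ, ← add_assoc n s 1, Nat.factorial_succ (n + s),
      show 2 * (n + s + 1) = 2 * (n + s) + 1 + 1 by ring, Nat.factorial_succ, Nat.factorial_succ]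
    push_cast
    linear_combination (2 * ((n : ℚ) + s) + 1 + 1) * (2 * ((n : ℚ) + s) + 1) * ih

theorem factorial_add_eq_prod (m d : ℕ) :
    ((m + d).factorial : ℚ) = m.factorial * ∏ i ∈ range d, ((m : ℚ) + 1 + i) := by
  induction d with
  | zero => simp
  | succ d ih =>
    rw [Finset.prod_range_succ, ← add_assoc, Nat.factorial_succ, Nat.cast_mul, ih]
    push_cast
    ring

theorem choose_mul_factorial_eq_prod (m d : ℕ) :
    (m.choose d : ℚ) * d.factorial = ∏ i ∈ range d, ((m : ℚ) - i) := by
  induction d with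
  | zero => simp
  | succ d ih =>
    have h : (m.choose (d + 1) : ℚ) * (d + 1) = m.choose d * ((m : ℚ) - d) := by
      rcases le_or_gt d m with hd | hd
      · rw [← Nat.cast_sub hd]
        exact_mod_cast Nat.choose_succ_right_eq m d
      · simp [Nat.choose_eq_zero_of_lt hd, Nat.choose_eq_zero_of_lt (hd.trans (Nat.lt_succ_self d))]
    rw [Finset.prod_range_succ, ← ih, Nat.factorial_succ]
    push_cast
    linear_combination (d.factorial : ℚ) * h

theorem catalan_mul_factorial (n : ℕ) :
    (catalan n : ℚ) * (n.factorial * (n + 1).factorial) = (2 * n).factorial := by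
  have h1 := succ_mul_catalan_eq_centralBinom n
  have h2 := Nat.choose_mul_factorial_mul_factorial (show n ≤ 2 * n by omega)
  rw [show 2 * n - n = n by omega, ← Nat.centralBinom_eq_two_mul_choose, ← h1] at h2
  rw [← h2, Nat.factorial_succ]
  push_cast
  ring

open Polynomial in
/-- The contribution to the numerator polynomial of the summand with index `s`. -/
noncomputable def diagonalTerm (r s : ℕ) : Polynomial ℚ :=
  C ((-1 : ℚ) ^ (r - s) / ((r - s).factorial * s.factorial)) *
    ((∏ i ∈ range s, C (2 : ℚ) * (C (2 : ℚ) * X + C (2 * (i : ℚ) + 1))) *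
      (∏ i ∈ range (r - s), (X + C ((s : ℚ) + 2 + i))) *
      (∏ i ∈ range (r - s), (X + C ((s : ℚ) - i))) * ∏ i ∈ range s, (X + C (i : ℚ)))

/-- The numerator polynomial of the `r`-th diagonal. -/
noncomputable def diagonalPoly (r : ℕ) : Polynomial ℚ := ∑ s ∈ range (r + 1), diagonalTerm r s

theorem natDegree_diagonalPoly_le (r : ℕ) : (diagonalPoly r).natDegree ≤ 2 * r := by
  refine Polynomial.natDegree_sum_le_of_forall_le _ _ fun s hs => ?_
  have hprod (d : ℕ) (f : ℕ → Polynomial ℚ) (hf : ∀ i, (f i).natDegree ≤ 1) :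
      (∏ i ∈ range d, f i).natDegree ≤ d :=
    (Polynomial.natDegree_prod_le _ _).trans
      ((Finset.sum_le_card_nsmul _ _ 1 fun i _ => hf i).trans (by simp))
  have hr : 2 * r = s + (r - s) + (r - s) + s := by
    have := Finset.mem_range.1 hs
    omega
  rw [hr]
  refine (Polynomial.natDegree_C_mul_le _ _).trans ?_
  refine Polynomial.natDegree_mul_le_of_le (Polynomial.natDegree_mul_le_of_le
    (Polynomial.natDegree_mul_le_of_le ?_ ?_) ?_) ?_ <;>
  · refine hprod _ _ fun i => ?_
    compute_degree

theorem eval_diagonalPoly (r : ℕ) (x : ℚ) : (diagonalPoly r).eval x =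
    ∑ s ∈ range (r + 1), (-1) ^ (r - s) / ((r - s).factorial * s.factorial) *
      ((∏ i ∈ range s, 2 * (2 * x + (2 * i + 1))) * (∏ i ∈ range (r - s), (x + (s + 2 + i))) *
        (∏ i ∈ range (r - s), (x + (s - i))) * ∏ i ∈ range s, (x + i)) := by
  simp only [diagonalPoly, diagonalTerm, Polynomial.eval_finsetSum, Polynomial.eval_mul,
    Polynomial.eval_prod, Polynomial.eval_add, Polynomial.eval_C, Polynomial.eval_X]

theorem opAvoidCount_zero_blocks (r : ℕ) :
    (opAvoidCount (0 + r) 0 3 p321 : ℚ) =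
      1 / (r + 1).factorial * (diagonalPoly r).eval 0 := by
  rw [opAvoidCount_p321_s16 _ 0 0 le_rfl, eval_diagonalPoly, Finset.sum_range_succ',
    Finset.sum_eq_zero fun s _ => by simp [Finset.prod_range_succ']]
  cases r with
  | zero => simp [surjCount_zero_zero]
  | succ r => simp [surjCount_succ_zero, ← add_assoc, Finset.prod_range_succ']

theorem opAvoidCount_diagonal (r n : ℕ) :
    (opAvoidCount (n + r) n 3 p321 : ℚ) =
      ((Nat.factorial (2 * n) : ℚ) /
        ((Nat.factorial n : ℚ) * (Nat.factorial (n + r + 1) : ℚ))) *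
          (diagonalPoly r).eval (n : ℚ) := by
  cases n with
  | zero => simpa using opAvoidCount_zero_blocks r
  | succ k =>
    rw [opAvoidCount_p321_s16 _ (k + 1) (k + 1) le_rfl, surjCount_of_le _ k (Nat.le_succ k),
      surjCount_diagonal, eval_diagonalPoly, Finset.mul_sum]
    refine Finset.sum_congr rfl fun s hs => ?_
    obtain ⟨d, rfl⟩ := Nat.exists_eq_add_of_le (Nat.lt_succ_iff.1 (Finset.mem_range.1 hs))
    have h1 := factorial_two_mul_add (k + 1) s
    have h2 := factorial_add_eq_prod (k + 1 + s + 1) d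
    have h3 := choose_mul_factorial_eq_prod (k + 1 + s) d
    have h4 : ((k + s).choose s : ℚ) * (s.factorial * k.factorial) = (k + s).factorial := by
      rw [← Nat.add_choose_mul_factorial_mul_factorial k s]
      push_cast
      ring
    have h4' := factorial_add_eq_prod k s
    have h5 := catalan_mul_factorial (k + 1 + s)
    have e2 : ∏ i ∈ range d, ((k + 1 + s + 1 : ℕ) + 1 + i : ℚ) =
        ∏ i ∈ range d, (((k + 1 : ℕ) : ℚ) + (s + 2 + i)) :=
      Finset.prod_congr rfl fun i _ => by push_cast; ring
    have e3 : ∏ i ∈ range d, ((k + 1 + s : ℕ) - i : ℚ) =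
        ∏ i ∈ range d, (((k + 1 : ℕ) : ℚ) + (s - i)) :=
      Finset.prod_congr rfl fun i _ => by push_cast; ring
    have e4 : ∏ i ∈ range s, ((k : ℚ) + 1 + i) = ∏ i ∈ range s, (((k + 1 : ℕ) : ℚ) + i) :=
      Finset.prod_congr rfl fun i _ => by push_cast; ring
    rw [e2] at h2
    rw [e3] at h3
    rw [e4] at h4'
    have hk : (k.factorial : ℚ) ≠ 0 := by exact_mod_cast k.factorial_ne_zero
    have h6 : ((k + s).choose s : ℚ) * s.factorial = ∏ i ∈ range s, (((k + 1 : ℕ) : ℚ) + i) :=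
      mul_left_cancel₀ hk (by linear_combination h4 + h4')
    rw [Nat.add_sub_cancel_left, ← h3, ← h6, show k + 1 + (s + d) + 1 = k + 1 + s + 1 + d by ring]
    have hn (m : ℕ) : (m.factorial : ℚ) ≠ 0 := by exact_mod_cast m.factorial_ne_zero
    have n1 := hn (k + 1)
    have n2 := hn (k + 1 + s + 1 + d)
    have n3 := hn (k + 1 + s)
    have n5 := hn d
    have n6 := hn s
    have hc : (catalan (k + 1 + s) : ℚ) * ((k + 1).factorial * (k + 1 + s + 1 + d).factorial) =
        (2 * (k + 1)).factorial * ((∏ i ∈ range s, 2 * (2 * ((k + 1 : ℕ) : ℚ) + (2 * i + 1))) *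
          ∏ i ∈ range d, (((k + 1 : ℕ) : ℚ) + (s + 2 + i))) := by
      refine mul_left_cancel₀ n3 ?_
      rw [h2]
      rw [← h5] at h1
      linear_combination (∏ i ∈ range d, (((k + 1 : ℕ) : ℚ) + (s + 2 + i))) * h1
    rw [div_mul_eq_mul_div, eq_div_iff (mul_ne_zero n1 n2)]
    field_simp
    linear_combination ((k + 1 + s).choose d : ℚ) * ((k + s).choose s : ℚ) * hc

theorem op_321_diagonals (r : ℕ) :
    ∃ Q : Polynomial ℚ, Q.natDegree ≤ 2 * r ∧
      (∀ n : ℕ,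
        (opAvoidCount (n + r) n 3 p321 : ℚ) =
          ((Nat.factorial (2 * n) : ℚ) /
              ((Nat.factorial n : ℚ) * (Nat.factorial (n + r + 1) : ℚ))) * Q.eval (n : ℚ)) ∧
      (r = 0 → ∀ x : ℚ, Q.eval x = 1) ∧
      (r = 1 → ∀ x : ℚ, Q.eval x = 3 * x ^ 2) ∧
      (r = 2 → ∀ x : ℚ, Q.eval x = (9 * x ^ 4 + 16 * x ^ 3 + 5 * x ^ 2 - 6 * x) / 2) := by
  refine ⟨diagonalPoly r, natDegree_diagonalPoly_le r, opAvoidCount_diagonal r, ?_, ?_, ?_⟩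
  · rintro rfl x
    simp [eval_diagonalPoly]
  · rintro rfl x
    rw [eval_diagonalPoly]
    simp [Finset.sum_range_succ]
    ring
  · rintro rfl x
    rw [eval_diagonalPoly]
    simp [Finset.sum_range_succ, Finset.prod_range_succ]
    ring
end
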